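/- Let U_s be an admissible shear flow satisfying the weighted decay conditions for a weight ω, and let η > 0. There exist constants C and K such that for every integer k with |k| ≥ K and every α ∈ ℂ satisfying Re α ≥ η/k and |Im α| ≥ 4/k, one has |Φ(iαk, k) − (1/k) f(α)| ≤ (C/k²) · (1/|Im α|) · (1/|α| + 1/√|α|), where f(α) := −2iΔ_s/α + 1/√α with the square root taken with positive real part, and Φ(μ, k) := lim_{y→∞} φ(y) for φ the unique solution of (μ − U_s)φ' + U_s' φ − (i/k) φ''' = F with φ(0) = 0, φ'(0) = 1, φ'(y) → 0 as y → ∞. -/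

import Mathlib

open MeasureTheory Filter Set

noncomputable section

/-- The source term `F(y) = 1 - U(y) + y U'(y)` of the eigenmode ODE. -/
def srcF (U : ℝ → ℝ) (y : ℝ) : ℝ := 1 - U y + y * deriv U y

/-- The displacement thickness `Δ_s = ∫₀^∞ (1 - U)`. -/
def deltaS (U : ℝ → ℝ) : ℝ := ∫ y in Ioi (0:ℝ), (1 - U y)

/-- An admissible shear flow: smooth, monotone, `U(0) = 0`, `U → 1`,
`U''(0) ≠ 0`, finitely many inflexion points, and the decay conditions of the paper. -/
structure AdmissibleShearFlow (U : ℝ → ℝ) : Prop where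
  smooth : ContDiff ℝ (⊤ : ℕ∞) U
  mem_Ico : ∀ y, 0 ≤ y → U y ∈ Ico (0:ℝ) 1
  zero_val : U 0 = 0
  deriv_pos : ∀ y, 0 ≤ y → 0 < deriv U y
  tendsto_one : Tendsto U atTop (nhds 1)
  snd_deriv_zero_ne : iteratedDeriv 2 U 0 ≠ 0
  finite_inflexions : {y : ℝ | 0 < y ∧ iteratedDeriv 2 U y = 0}.Finite
  integrable_defect : IntegrableOn (fun y => 1 - U y) (Ioi (0:ℝ))
  derivs_bounded : ∀ j : ℕ, 1 ≤ j → j ≤ 3 →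
    ∃ M : ℝ, ∀ y, 0 ≤ y → |iteratedDeriv j U y| ≤ M
  decay_ratio₁ : Tendsto (fun y => (1 - U y) ^ 2 / deriv U y) atTop (nhds 0)
  decay_ratio₂ : Tendsto (fun y => y * (1 - U y)) atTop (nhds 0)
  decay_ratio₃ : IntegrableOn
    (fun y => (1 - U y) ^ 2 * iteratedDeriv 2 U y / (deriv U y) ^ 2) (Ioi (0:ℝ))
  kappa_decay : ∃ κ : ℝ, 0 < κ ∧ κ < 1/2 ∧ ∃ yκ > (0:ℝ), ∃ cκ > (0:ℝ),
    ∀ y, yκ ≤ y →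
      (1 - U y) ^ ((2:ℝ) - κ) * iteratedDeriv 2 U y ≤ -cκ * (deriv U y) ^ 3

/-- `φ` is a smooth solution of the eigenmode problem
`(μ - U_s)φ' + U_s'φ - (i/k)φ''' = F`, `φ(0) = 0`, `φ'(0) = 1`, `φ' → 0`, `φ → L`. -/
def IsEigSolution (U : ℝ → ℝ) (μ : ℂ) (k : ℝ) (L : ℂ) (φ : ℝ → ℂ) : Prop :=
  ContDiff ℝ (⊤ : ℕ∞) φ ∧
  (∀ y, 0 ≤ y →
    (μ - (U y : ℂ)) * deriv φ y + ((deriv U y : ℝ) : ℂ) * φ y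
      - Complex.I / (k : ℂ) * iteratedDeriv 3 φ y = (srcF U y : ℂ)) ∧
  φ 0 = 0 ∧ deriv φ 0 = 1 ∧
  Tendsto (deriv φ) atTop (nhds 0) ∧
  Tendsto φ atTop (nhds L)

/-- Same problem without the prescribed limit at infinity. -/
def IsBLSolution (U : ℝ → ℝ) (μ : ℂ) (k : ℝ) (φ : ℝ → ℂ) : Prop :=
  ContDiff ℝ (⊤ : ℕ∞) φ ∧
  (∀ y, 0 ≤ y →
    (μ - (U y : ℂ)) * deriv φ y + ((deriv U y : ℝ) : ℂ) * φ y
      - Complex.I / (k : ℂ) * iteratedDeriv 3 φ y = (srcF U y : ℂ)) ∧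
  φ 0 = 0 ∧ deriv φ 0 = 1 ∧ Tendsto (deriv φ) atTop (nhds 0)

/-- Cauchy principal value `PV ∫₀¹ h(u)/(u - a) du`. -/
def pvIntegral (h : ℝ → ℝ) (a : ℝ) : ℝ :=
  limUnder (nhdsWithin (0:ℝ) (Ioi 0))
    (fun ε => ∫ u in Ioo (0:ℝ) 1 \ Ioo (a - ε) (a + ε), h u / (u - a))

/-- Inverse of the shear flow on `[0, ∞)`. -/
def shearInv (U : ℝ → ℝ) (u : ℝ) : ℝ := Function.invFunOn U (Ici 0) u

/-- `g(u) = (1-u)² U''(U⁻¹(u)) / (U'(U⁻¹(u)))³`. -/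
def gfun (U : ℝ → ℝ) (u : ℝ) : ℝ :=
  (1 - u) ^ 2 * iteratedDeriv 2 U (shearInv U u) / (deriv U (shearInv U u)) ^ 3

/-- `G(a) = 1/(a U'(0)) + PV ∫₀¹ g(u)/(u-a) du + iπ g(a)`. -/
def Gfun (U : ℝ → ℝ) (a : ℝ) : ℂ :=
  ((1 / (a * deriv U 0) + pvIntegral (gfun U) a : ℝ) : ℂ)
    + Complex.I * ((Real.pi * gfun U a : ℝ) : ℂ)

/-- Crossing abscissa `χ(y) = Re G(U(y))`. -/
def chiAbscissa (U : ℝ → ℝ) (y : ℝ) : ℝ := (Gfun U (U y)).re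

/-- `ξ(γ)`: number of zeros of `U''` in `(0,∞)` with `χ(yᵢ) = γ`. -/
def xiEq (U : ℝ → ℝ) (γ : ℝ) : ℕ :=
  {y : ℝ | 0 < y ∧ iteratedDeriv 2 U y = 0 ∧ chiAbscissa U y = γ}.ncard

/-- `ξ₊(γ)`: zeros of `U''` with `χ(yᵢ) < γ`, `U'' < 0` on the left and `U'' > 0`
on the right. -/
def xiPlus (U : ℝ → ℝ) (γ : ℝ) : ℕ :=
  {y : ℝ | 0 < y ∧ iteratedDeriv 2 U y = 0 ∧ chiAbscissa U y < γ ∧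
    ∃ δ > (0:ℝ), (∀ z ∈ Ioo (y - δ) y, iteratedDeriv 2 U z < 0) ∧
      (∀ z ∈ Ioo y (y + δ), 0 < iteratedDeriv 2 U z)}.ncard

/-- `ξ₋(γ)`: zeros of `U''` with `χ(yᵢ) < γ`, `U'' > 0` on the left and `U'' < 0`
on the right. -/
def xiMinus (U : ℝ → ℝ) (γ : ℝ) : ℕ :=
  {y : ℝ | 0 < y ∧ iteratedDeriv 2 U y = 0 ∧ chiAbscissa U y < γ ∧
    ∃ δ > (0:ℝ), (∀ z ∈ Ioo (y - δ) y, 0 < iteratedDeriv 2 U z) ∧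
      (∀ z ∈ Ioo y (y + δ), iteratedDeriv 2 U z < 0)}.ncard

/-- `Φ_inv(μ) = (μ - 1) ∫₀^∞ F(y)/(μ - U(y))² dy`. -/
def PhiInv (U : ℝ → ℝ) (μ : ℂ) : ℂ :=
  (μ - 1) * ∫ y in Ioi (0:ℝ), (srcF U y : ℂ) / (μ - (U y : ℂ)) ^ 2

/-- A weight function `ω ≥ 1` with `C_ω < ∞`. -/
structure WeightFn (ω : ℝ → ℝ) : Prop where
  pos : ∀ y, 0 ≤ y → 0 < ω y
  contDiff : ContDiff ℝ 1 ω
  one_le : ∀ y, 0 ≤ y → 1 ≤ ω y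
  integrable_inv : IntegrableOn (fun y => 1 / ω y) (Ioi (0:ℝ))
  deriv_ratio_bdd : ∃ M : ℝ, ∀ y, 0 ≤ y → |deriv ω y / ω y| ≤ M
  log_ratio_bdd : ∃ M : ℝ, ∀ y, 0 ≤ y → Real.log (ω y) / (1 + y) ≤ M

/-- Weighted decay conditions: `(1-U_s) ∈ L²(ω)` and `(1+y)U_s^{(j)} ∈ L²(ω)`, `j = 1,2,3`. -/
def WeightedDecay (U ω : ℝ → ℝ) : Prop :=
  IntegrableOn (fun y => (1 - U y) ^ 2 * ω y) (Ioi (0:ℝ)) ∧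
  ∀ j : ℕ, 1 ≤ j → j ≤ 3 →
    IntegrableOn (fun y => ((1 + y) * iteratedDeriv j U y) ^ 2 * ω y) (Ioi (0:ℝ))

/-- Membership in the weighted space `L²(ω)`. -/
def MemL2w (ω : ℝ → ℝ) (f : ℝ → ℂ) : Prop :=
  IntegrableOn (fun y => ‖f y‖ ^ 2 * ω y) (Ioi (0:ℝ))

/-- The `L²(ω)` norm. -/
def wNorm (ω : ℝ → ℝ) (f : ℝ → ℂ) : ℝ :=
  Real.sqrt (∫ y in Ioi (0:ℝ), ‖f y‖ ^ 2 * ω y)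

/-- `φ` solves the homogeneous-boundary-conditions resolvent problem with forcing `f`. -/
def SolvesHom (U : ℝ → ℝ) (μ : ℂ) (k : ℝ) (f φ : ℝ → ℂ) : Prop :=
  ContDiff ℝ 2 φ ∧
  (∀ᵐ y ∂(volume.restrict (Ioi (0:ℝ))),
    (μ - (U y : ℂ)) * deriv φ y + ((deriv U y : ℝ) : ℂ) * φ y
      - Complex.I / (k : ℂ) * iteratedDeriv 3 φ y = f y) ∧
  φ 0 = 0 ∧ deriv φ 0 = 0 ∧ Tendsto (deriv φ) atTop (nhds 0)

/-- Parameterization on `[0,1]` of the contour `C_η`: the segment from `iη` to `1 + iη`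
followed by the upper half-circle of radius `1/2` centered at `1/2 + iη`. -/
def Ceta (η : ℝ) (t : ℝ) : ℂ :=
  if t ≤ 1/2 then ((2*t : ℝ) : ℂ) + (η : ℂ) * Complex.I
  else (1/2 : ℂ) + (η : ℂ) * Complex.I
    + (1/2 : ℂ) * Complex.exp (((Real.pi * (2*t - 1) : ℝ)) * Complex.I)

/-- Winding number `(1/2πi) ∮ dz/(z - p)` of a closed curve parameterized on `[0,1]`. -/
def windingNumber (c : ℝ → ℂ) (p : ℂ) : ℂ :=
  (((2 * Real.pi : ℝ) : ℂ) * Complex.I)⁻¹ * ∫ t in (0:ℝ)..1, deriv c t / (c t - p)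

/-- `q_μ(x) = |μ - x|⁴ - (2μ - 1 - x)(μ̄ - x)²`. -/
def qmu (μ : ℂ) (x : ℝ) : ℂ :=
  ((‖μ - (x:ℂ)‖ ^ 4 : ℝ) : ℂ) - (2*μ - 1 - (x:ℂ)) * ((starRingEnd ℂ) μ - (x:ℂ))^2

/-- `f(α) = -2iΔ_s/α + 1/√α`, principal square root (positive real part for `Re α > 0`). -/
def fIBL (Δ : ℝ) (α : ℂ) : ℂ := (-2 * Complex.I * (Δ:ℂ)) / α + 1 / (α ^ (1/2 : ℂ))

/-- Facts on the flow that the proof uses. -/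
structure BasicFlow (U : ℝ → ℝ) (M : ℝ) : Prop where
  smooth : ContDiff ℝ (⊤ : ℕ∞) U
  nonneg : ∀ y, 0 ≤ y → 0 ≤ U y
  le_one : ∀ y, 0 ≤ y → U y ≤ 1
  M_nonneg : 0 ≤ M
  d_nonneg : ∀ y, 0 ≤ y → 0 ≤ deriv U y
  d_le : ∀ y, 0 ≤ y → deriv U y ≤ M
  lim : Tendsto U atTop (nhds 1)
  F_int : IntegrableOn (srcF U) (Ioi 0)
  F_eq : ∫ y in Ioi (0:ℝ), srcF U y = 2 * deltaS U

lemma AdmissibleShearFlow.basic {U : ℝ → ℝ} (hU : AdmissibleShearFlow U) :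
    ∃ M, BasicFlow U M := by
  obtain ⟨M, hM⟩ := hU.derivs_bounded 1 le_rfl (by norm_num)
  have hdiff : Differentiable ℝ U := hU.smooth.differentiable (by simp)
  have hcont : Continuous U := hU.smooth.continuous
  have hg : ∀ x ∈ Ici (0:ℝ), HasDerivAt
      (fun y => (∫ z in (0:ℝ)..y, (1 - U z)) - y * (1 - U y)) (x * deriv U x) x := by
    intro x _
    have h1 : HasDerivAt (fun y => ∫ z in (0:ℝ)..y, (1 - U z)) (1 - U x) x :=
      intervalIntegral.integral_hasDerivAt_right
        ((continuous_const.sub hcont).intervalIntegrable _ _)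
        ((continuous_const.sub hcont).stronglyMeasurableAtFilter _ _)
        (continuous_const.sub hcont).continuousAt
    have h2 := (hasDerivAt_id x).mul ((hdiff x).hasDerivAt.const_sub 1)
    refine (h1.sub h2).congr_deriv ?_
    simp only [id]; ring
  have hpos : ∀ x ∈ Ioi (0:ℝ), 0 ≤ x * deriv U x := fun x hx =>
    mul_nonneg (le_of_lt hx) (hU.deriv_pos x (le_of_lt hx)).le
  have hlim : Tendsto (fun y => (∫ z in (0:ℝ)..y, (1 - U z)) - y * (1 - U y)) atTop
      (nhds (deltaS U)) := by
    have := (intervalIntegral_tendsto_integral_Ioi 0 hU.integrable_defect tendsto_id).sub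
      hU.decay_ratio₂
    simpa [deltaS] using this
  have hi := integrableOn_Ioi_deriv_of_nonneg' hg hpos hlim
  have he := integral_Ioi_of_hasDerivAt_of_nonneg' hg hpos hlim
  simp only [intervalIntegral.integral_same, zero_mul, sub_zero] at he
  refine ⟨M, hU.smooth, fun y hy => (hU.mem_Ico y hy).1, fun y hy => (hU.mem_Ico y hy).2.le, ?_,
    fun y hy => (hU.deriv_pos y hy).le, ?_, hU.tendsto_one, ?_, ?_⟩
  · exact (abs_nonneg _).trans (hM 0 le_rfl)
  · intro y hy
    have := hM y hy
    rw [iteratedDeriv_one] at this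
    exact (le_abs_self _).trans this
  · exact hU.integrable_defect.add hi
  · have : ∫ y in Ioi (0:ℝ), srcF U y = (∫ y in Ioi (0:ℝ), (1 - U y)) +
        ∫ y in Ioi (0:ℝ), y * deriv U y := integral_add hU.integrable_defect hi
    rw [this, he]
    unfold deltaS; ring

/-- One-sided exponential kernel. -/
def KB (r y z : ℝ) : ENNReal := if y < z then ENNReal.ofReal (Real.exp (-(r * (z - y)))) else 0

/-- Weight. -/
def Wt (U : ℝ → ℝ) (δ y : ℝ) : ENNReal := ENNReal.ofReal (Real.exp (-(4 * U y + δ * y)))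

lemma measurable_KB (r : ℝ) : Measurable (Function.uncurry (KB r)) := by
  unfold KB Function.uncurry
  refine Measurable.ite (measurableSet_lt measurable_fst measurable_snd) ?_ measurable_const
  fun_prop

lemma schur (K : ℝ → ℝ → ENNReal) (hK : Measurable (Function.uncurry K)) (h V W : ℝ → ENNReal)
    (hh : AEMeasurable h (volume.restrict (Ioi 0))) (hV : Measurable V) (C : ENNReal)
    (hb : ∀ z ∈ Ioi (0:ℝ), ∫⁻ y in Ioi (0:ℝ), V y * K y z ≤ C * W z)
    (hW : Measurable W) :
    ∫⁻ y in Ioi (0:ℝ), V y * ∫⁻ z in Ioi (0:ℝ), K y z * h z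
      ≤ C * ∫⁻ z in Ioi (0:ℝ), W z * h z := by
  have hm : AEMeasurable (Function.uncurry fun y z => V y * (K y z * h z))
      ((volume.restrict (Ioi (0:ℝ))).prod (volume.restrict (Ioi (0:ℝ)))) := by
    have h2 : AEMeasurable (fun p : ℝ × ℝ => h p.2)
      ((volume.restrict (Ioi (0:ℝ))).prod (volume.restrict (Ioi (0:ℝ)))) := hh.comp_snd
    have h1 : Measurable (fun p : ℝ × ℝ => V p.1) := hV.comp measurable_fst
    exact h1.aemeasurable.mul (hK.aemeasurable.mul h2)
  calc ∫⁻ y in Ioi (0:ℝ), V y * ∫⁻ z in Ioi (0:ℝ), K y z * h z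
      = ∫⁻ y in Ioi (0:ℝ), ∫⁻ z in Ioi (0:ℝ), V y * (K y z * h z) := by
        refine lintegral_congr fun y => ?_
        rw [lintegral_const_mul'']
        exact (hK.comp measurable_prodMk_left).aemeasurable.mul hh
    _ = ∫⁻ z in Ioi (0:ℝ), ∫⁻ y in Ioi (0:ℝ), V y * (K y z * h z) :=
        lintegral_lintegral_swap hm
    _ = ∫⁻ z in Ioi (0:ℝ), (∫⁻ y in Ioi (0:ℝ), V y * K y z) * h z := by
        refine lintegral_congr fun z => ?_
        rw [← lintegral_mul_const]
        · simp only [mul_assoc]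
        · exact hV.mul (hK.comp measurable_prodMk_right)
    _ ≤ ∫⁻ z in Ioi (0:ℝ), C * (W z * h z) := by
        refine setLIntegral_mono' measurableSet_Ioi fun z hz => ?_
        rw [← mul_assoc]
        gcongr
        exact hb z hz
    _ = C * ∫⁻ z in Ioi (0:ℝ), W z * h z := by
        rw [lintegral_const_mul'']
        exact hW.aemeasurable.mul hh

section
variable {U : ℝ → ℝ} {M : ℝ}

lemma BasicFlow.cont (hU : BasicFlow U M) : Continuous U := hU.smooth.continuous
lemma BasicFlow.diff (hU : BasicFlow U M) : Differentiable ℝ U :=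
  hU.smooth.differentiable (by simp)
lemma BasicFlow.dcont (hU : BasicFlow U M) : Continuous (deriv U) :=
  hU.smooth.continuous_deriv (by simp)

lemma BasicFlow.mono (hU : BasicFlow U M) {y z : ℝ} (hy : 0 ≤ y) (hz : y ≤ z) : U y ≤ U z := by
  have : MonotoneOn U (Ici 0) := by
    apply monotoneOn_of_deriv_nonneg (convex_Ici 0) hU.cont.continuousOn hU.diff.differentiableOn
    intro x hx
    rw [interior_Ici] at hx
    exact hU.d_nonneg x (le_of_lt hx)
  exact this hy (hy.trans hz) hz

lemma BasicFlow.lip (hU : BasicFlow U M) {y z : ℝ} (hy : 0 ≤ y) (hz : y ≤ z) :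
    U z - U y ≤ M * (z - y) := by
  apply (convex_Ici (0:ℝ)).image_sub_le_mul_sub_of_deriv_le hU.cont.continuousOn
    hU.diff.differentiableOn _ y hy z (hy.trans hz) hz
  intro x hx
  rw [interior_Ici] at hx
  exact hU.d_le x (le_of_lt hx)

lemma measurable_Wt (hU : BasicFlow U M) (δ : ℝ) : Measurable (Wt U δ) := by
  have := hU.cont
  unfold Wt
  fun_prop

lemma Wt_KB_le (hU : BasicFlow U M) {δ r c : ℝ} (hc : 4 * M + δ ≤ c) (hr : c < r)
    {z : ℝ} (_hz : 0 < z) :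
    ∫⁻ y in Ioi (0:ℝ), Wt U δ y * KB r y z ≤ ENNReal.ofReal (1 / (r - c)) * Wt U δ z := by
  have hrc : 0 < r - c := sub_pos.2 hr
  calc ∫⁻ y in Ioi (0:ℝ), Wt U δ y * KB r y z
      ≤ ∫⁻ y in Ioi (0:ℝ), (Iic z).indicator
        (fun y => Wt U δ z * ENNReal.ofReal (Real.exp (-((r - c) * z)) * Real.exp ((r - c) * y))) y := by
        refine setLIntegral_mono' measurableSet_Ioi fun y hy => ?_
        unfold KB
        split_ifs with hyz
        · rw [indicator_of_mem (by exact hyz.le)]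
          unfold Wt
          rw [← ENNReal.ofReal_mul (by positivity), ← ENNReal.ofReal_mul (by positivity),
            ← Real.exp_add, ← Real.exp_add, ← Real.exp_add]
          apply ENNReal.ofReal_le_ofReal
          apply Real.exp_le_exp.2
          have := hU.lip (le_of_lt hy) hyz.le
          nlinarith
        · simp
    _ ≤ ∫⁻ y, (Iic z).indicator
        (fun y => Wt U δ z * ENNReal.ofReal (Real.exp (-((r - c) * z)) * Real.exp ((r - c) * y))) y :=
        setLIntegral_le_lintegral _ _
    _ = ENNReal.ofReal (1 / (r - c)) * Wt U δ z := by
        rw [lintegral_indicator measurableSet_Iic, lintegral_const_mul _ (by fun_prop),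
          ← ofReal_integral_eq_lintegral_ofReal, integral_const_mul, integral_exp_mul_Iic hrc,
          mul_comm]
        · congr 2
          rw [← mul_div_assoc, ← Real.exp_add]; simp
        · exact (integrableOn_exp_mul_Iic hrc z).const_mul _
        · exact Eventually.of_forall fun y => by positivity

lemma Wt_KA_le (hU : BasicFlow U M) {δ r : ℝ} (hδ : 0 ≤ δ) (hr : 0 < r)
    {z : ℝ} (hz : 0 < z) :
    ∫⁻ y in Ioi (0:ℝ), Wt U δ y * KB r z y ≤ ENNReal.ofReal (1 / r) * Wt U δ z := by
  have hr' : -r < 0 := by linarith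
  calc ∫⁻ y in Ioi (0:ℝ), Wt U δ y * KB r z y
      ≤ ∫⁻ y in Ioi (0:ℝ), (Ioi z).indicator
        (fun y => Wt U δ z * ENNReal.ofReal (Real.exp (r * z) * Real.exp (-r * y))) y := by
        refine setLIntegral_mono' measurableSet_Ioi fun y hy => ?_
        unfold KB
        split_ifs with hyz
        · rw [indicator_of_mem (by exact hyz)]
          unfold Wt
          rw [← ENNReal.ofReal_mul (by positivity), ← ENNReal.ofReal_mul (by positivity),
            ← Real.exp_add, ← Real.exp_add, ← Real.exp_add]
          apply ENNReal.ofReal_le_ofReal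
          apply Real.exp_le_exp.2
          have := hU.mono hz.le hyz.le
          nlinarith
        · simp
    _ ≤ ∫⁻ y, (Ioi z).indicator
        (fun y => Wt U δ z * ENNReal.ofReal (Real.exp (r * z) * Real.exp (-r * y))) y :=
        setLIntegral_le_lintegral _ _
    _ = ENNReal.ofReal (1 / r) * Wt U δ z := by
        rw [lintegral_indicator measurableSet_Ioi, lintegral_const_mul _ (by fun_prop),
          ← ofReal_integral_eq_lintegral_ofReal, integral_const_mul, integral_exp_mul_Ioi hr',
          mul_comm]
        · congr 2
          rw [neg_div_neg_eq, ← mul_div_assoc, ← Real.exp_add]; simp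
        · exact (integrableOn_exp_mul_Ioi hr' z).const_mul _
        · exact Eventually.of_forall fun y => by positivity

lemma Wt_KP_le (hU : BasicFlow U M) {δ : ℝ} (hδ : 0 ≤ δ)
    {z : ℝ} (hz : 0 < z) :
    ∫⁻ y in Ioi (0:ℝ), (Wt U δ y * ENNReal.ofReal (deriv U y)) * KB 0 z y
      ≤ ENNReal.ofReal (1 / 4) * Wt U δ z := by
  have hder : ∀ x ∈ Ici z, HasDerivAt (fun y => - (1/4) * Real.exp (-(4 * U y)))
      (deriv U x * Real.exp (-(4 * U x))) x := by
    intro x _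
    have := ((((hU.diff x).hasDerivAt.const_mul 4).neg).exp).const_mul (-(1/4:ℝ))
    refine this.congr_deriv ?_
    simp only [Pi.neg_apply]
    ring
  have hpos : ∀ x ∈ Ioi z, 0 ≤ deriv U x * Real.exp (-(4 * U x)) := fun x hx =>
    mul_nonneg (hU.d_nonneg x (hz.le.trans (le_of_lt hx))) (Real.exp_pos _).le
  have hlim : Tendsto (fun y => - (1/4) * Real.exp (-(4 * U y))) atTop
      (nhds (-(1/4) * Real.exp (-(4 * 1)))) := by
    apply Tendsto.const_mul
    exact (Real.continuous_exp.tendsto _).comp (hU.lim.const_mul 4).neg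
  have hi := integrableOn_Ioi_deriv_of_nonneg' hder hpos hlim
  have he := integral_Ioi_of_hasDerivAt_of_nonneg' hder hpos hlim
  have hc := hU.dcont
  have hc' := hU.cont
  calc ∫⁻ y in Ioi (0:ℝ), (Wt U δ y * ENNReal.ofReal (deriv U y)) * KB 0 z y
      ≤ ∫⁻ y in Ioi (0:ℝ), (Ioi z).indicator
        (fun y => ENNReal.ofReal (Real.exp (-(δ * z))) *
          ENNReal.ofReal (deriv U y * Real.exp (-(4 * U y)))) y := by
        refine setLIntegral_mono' measurableSet_Ioi fun y hy => ?_
        unfold KB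
        split_ifs with hyz
        · rw [indicator_of_mem (by exact hyz)]
          have := hU.d_nonneg y (le_of_lt hy)
          unfold Wt
          rw [← ENNReal.ofReal_mul (by positivity), ← ENNReal.ofReal_mul (by positivity),
            ← ENNReal.ofReal_mul (by positivity)]
          apply ENNReal.ofReal_le_ofReal
          have h1 : Real.exp (-(4 * U y + δ * y)) ≤ Real.exp (-(δ * z)) * Real.exp (-(4 * U y)) := by
            rw [← Real.exp_add]
            apply Real.exp_le_exp.2
            nlinarith
          simp only [zero_mul, neg_zero, Real.exp_zero, mul_one]
          nlinarith
        · simp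
    _ ≤ ∫⁻ y, (Ioi z).indicator
        (fun y => ENNReal.ofReal (Real.exp (-(δ * z))) *
          ENNReal.ofReal (deriv U y * Real.exp (-(4 * U y)))) y :=
        setLIntegral_le_lintegral _ _
    _ ≤ ENNReal.ofReal (1 / 4) * Wt U δ z := by
        rw [lintegral_indicator measurableSet_Ioi, lintegral_const_mul _ (by fun_prop),
          ← ofReal_integral_eq_lintegral_ofReal hi, he]
        · unfold Wt
          rw [← ENNReal.ofReal_mul (by positivity), ← ENNReal.ofReal_mul (by positivity)]
          apply ENNReal.ofReal_le_ofReal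
          have h1 : Real.exp (-(4 * U z + δ * z)) = Real.exp (-(δ * z)) * Real.exp (-(4 * U z)) := by
            rw [← Real.exp_add]
            congr 1; ring
          rw [h1]
          have h2 := Real.exp_pos (-(4 * 1 : ℝ))
          have h3 := Real.exp_pos (-(δ * z))
          have h4 := mul_pos h2 h3
          generalize Real.exp (-(4 * 1 : ℝ)) = e1 at *
          generalize Real.exp (-(δ * z)) = e2 at *
          generalize Real.exp (-(4 * U z)) = e3 at *
          linarith [mul_comm e1 e2, (by ring : e2 * (-(1 / 4) * e1 - -(1 / 4) * e3) = -(1/4) * (e1 * e2) + 1/4 * (e2 * e3))]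
        · exact (ae_restrict_iff' measurableSet_Ioi).2 (Eventually.of_forall hpos)

/-- The chain of estimates. -/
lemma chain (hU : BasicFlow U M) {δ r c : ℝ} (hδ : 0 ≤ δ) (hc : 4 * M + δ ≤ c) (hr : c < r)
    (κ : ENNReal) (v u p h a f : ℝ → ENNReal)
    (hu : AEMeasurable u (volume.restrict (Ioi 0)))
    (hp : AEMeasurable p (volume.restrict (Ioi 0)))
    (hh : AEMeasurable h (volume.restrict (Ioi 0)))
    (ha : AEMeasurable a (volume.restrict (Ioi 0)))
    (h1 : ∀ y, 0 < y → v y ≤ a y + ∫⁻ z in Ioi (0:ℝ), KB r z y * p z)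
    (h2 : ∀ y, 0 < y → p y ≤ κ * ∫⁻ z in Ioi (0:ℝ), KB r y z * h z)
    (h3 : ∀ y, 0 < y → h y ≤ u y + ENNReal.ofReal (deriv U y) *
        (∫⁻ z in Ioi (0:ℝ), KB 0 z y * u z) + f y) :
    ∫⁻ y in Ioi (0:ℝ), Wt U δ y * v y ≤ (∫⁻ y in Ioi (0:ℝ), Wt U δ y * a y) +
      ENNReal.ofReal (1 / r) * (κ * (ENNReal.ofReal (1 / (r - c)) *
        ((1 + ENNReal.ofReal (1 / 4)) * (∫⁻ y in Ioi (0:ℝ), Wt U δ y * u y) +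
          ∫⁻ y in Ioi (0:ℝ), Wt U δ y * f y))) := by
  have hM := hU.M_nonneg
  have hr0 : 0 < r := by linarith
  have hW := measurable_Wt hU δ
  have hKs : Measurable (Function.uncurry fun y z => KB r z y) :=
    (measurable_KB r).comp measurable_swap
  have hKs0 : Measurable (Function.uncurry fun y z => KB 0 z y) :=
    (measurable_KB 0).comp measurable_swap
  have hWd : Measurable (fun y => Wt U δ y * ENNReal.ofReal (deriv U y)) := by
    have := hU.dcont
    exact hW.mul (by fun_prop)
  calc ∫⁻ y in Ioi (0:ℝ), Wt U δ y * v y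
      ≤ ∫⁻ y in Ioi (0:ℝ), (Wt U δ y * a y +
          Wt U δ y * ∫⁻ z in Ioi (0:ℝ), KB r z y * p z) := by
        refine setLIntegral_mono' measurableSet_Ioi fun y hy => ?_
        rw [← mul_add]
        gcongr
        exact h1 y hy
    _ = (∫⁻ y in Ioi (0:ℝ), Wt U δ y * a y) +
          ∫⁻ y in Ioi (0:ℝ), Wt U δ y * ∫⁻ z in Ioi (0:ℝ), KB r z y * p z :=
        lintegral_add_left' (hW.aemeasurable.mul ha) _
    _ ≤ (∫⁻ y in Ioi (0:ℝ), Wt U δ y * a y) +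
          ENNReal.ofReal (1 / r) * ∫⁻ y in Ioi (0:ℝ), Wt U δ y * p y := by
        gcongr
        exact schur _ hKs p _ _ hp hW _ (fun z hz => Wt_KA_le hU hδ hr0 hz) hW
    _ ≤ _ := by
        gcongr
        calc ∫⁻ y in Ioi (0:ℝ), Wt U δ y * p y
            ≤ ∫⁻ y in Ioi (0:ℝ), κ * (Wt U δ y * ∫⁻ z in Ioi (0:ℝ), KB r y z * h z) := by
              refine setLIntegral_mono' measurableSet_Ioi fun y hy => ?_
              rw [mul_left_comm]
              gcongr
              exact h2 y hy
          _ = κ * ∫⁻ y in Ioi (0:ℝ), (Wt U δ y * ∫⁻ z in Ioi (0:ℝ), KB r y z * h z) := by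
              rw [lintegral_const_mul'']
              refine hW.aemeasurable.mul ?_
              have : AEMeasurable (Function.uncurry fun y z => KB r y z * h z)
                ((volume.restrict (Ioi (0:ℝ))).prod (volume.restrict (Ioi (0:ℝ)))) :=
                (measurable_KB r).aemeasurable.mul hh.comp_snd
              exact this.lintegral_prod_right'
          _ ≤ κ * (ENNReal.ofReal (1 / (r - c)) * ∫⁻ y in Ioi (0:ℝ), Wt U δ y * h y) := by
              gcongr
              exact schur _ (measurable_KB r) h _ _ hh hW _ (fun z hz => Wt_KB_le hU hc hr hz) hW
          _ ≤ _ := by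
              gcongr
              calc ∫⁻ y in Ioi (0:ℝ), Wt U δ y * h y
                  ≤ ∫⁻ y in Ioi (0:ℝ), ((Wt U δ y * u y +
                    (Wt U δ y * ENNReal.ofReal (deriv U y)) *
                      (∫⁻ z in Ioi (0:ℝ), KB 0 z y * u z)) + Wt U δ y * f y) := by
                    refine setLIntegral_mono' measurableSet_Ioi fun y hy => ?_
                    rw [mul_assoc, ← mul_add, ← mul_add]
                    gcongr
                    exact h3 y hy
                _ = (∫⁻ y in Ioi (0:ℝ), Wt U δ y * u y) +
                    (∫⁻ y in Ioi (0:ℝ), (Wt U δ y * ENNReal.ofReal (deriv U y)) *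
                      (∫⁻ z in Ioi (0:ℝ), KB 0 z y * u z)) +
                      ∫⁻ y in Ioi (0:ℝ), Wt U δ y * f y := by
                    have : AEMeasurable (Function.uncurry fun y z => KB 0 z y * u z)
                      ((volume.restrict (Ioi (0:ℝ))).prod (volume.restrict (Ioi (0:ℝ)))) :=
                      hKs0.aemeasurable.mul hu.comp_snd
                    rw [lintegral_add_left', lintegral_add_left']
                    · exact hW.aemeasurable.mul hu
                    · exact (hW.aemeasurable.mul hu).add
                        (hWd.aemeasurable.mul this.lintegral_prod_right')
                _ ≤ _ := by
                    rw [add_mul, one_mul]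
                    gcongr
                    exact schur _ hKs0 u _ _ hu hWd _ (fun z hz => Wt_KP_le hU hδ hz) hW
end

section
variable {U : ℝ → ℝ} {M : ℝ}

lemma chain2 (hU : BasicFlow U M) {δ r k : ℝ} (hδ : 0 ≤ δ) (hδ1 : δ ≤ 1)
    (hr : 6 * (4 * M + 1) ≤ r) (hk : 0 ≤ k) (hkr : 2 * k ≤ r ^ 2)
    (v u p h a f : ℝ → ENNReal)
    (hu : AEMeasurable u (volume.restrict (Ioi 0)))
    (hp : AEMeasurable p (volume.restrict (Ioi 0)))
    (hh : AEMeasurable h (volume.restrict (Ioi 0)))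
    (ha : AEMeasurable a (volume.restrict (Ioi 0)))
    (h1 : ∀ y, 0 < y → v y ≤ a y + ∫⁻ z in Ioi (0:ℝ), KB r z y * p z)
    (h2 : ∀ y, 0 < y → p y ≤ ENNReal.ofReal k * ∫⁻ z in Ioi (0:ℝ), KB r y z * h z)
    (h3 : ∀ y, 0 < y → h y ≤ u y + ENNReal.ofReal (deriv U y) *
        (∫⁻ z in Ioi (0:ℝ), KB 0 z y * u z) + f y) :
    ∫⁻ y in Ioi (0:ℝ), Wt U δ y * v y ≤ (∫⁻ y in Ioi (0:ℝ), Wt U δ y * a y) +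
      (ENNReal.ofReal (3 / 4) * (∫⁻ y in Ioi (0:ℝ), Wt U δ y * u y) +
          ENNReal.ofReal (2 * k / r ^ 2) * ∫⁻ y in Ioi (0:ℝ), Wt U δ y * f y) := by
  have hM := hU.M_nonneg
  have hr0 : 0 < r := by linarith
  set c := 4 * M + 1 with hc
  have hcr : c < r := by linarith
  have hrc : 0 < r - c := by linarith
  refine (chain hU hδ (c := c) (by linarith) hcr (ENNReal.ofReal k) v u p h a f hu hp hh ha h1 h2
    h3).trans ?_
  gcongr
  have e1 : (1 : ENNReal) + ENNReal.ofReal (1 / 4) = ENNReal.ofReal (5 / 4) := by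
    rw [← ENNReal.ofReal_one, ← ENNReal.ofReal_add] <;> norm_num
  rw [e1, ← mul_assoc, ← mul_assoc, mul_add, ← mul_assoc,
    ← ENNReal.ofReal_mul (by positivity), ← ENNReal.ofReal_mul (by positivity),
    ← ENNReal.ofReal_mul (by positivity)]
  have key : 1 / r * k * (1 / (r - c)) ≤ 6 / 5 * (k / r ^ 2) := by
    have : 1 / r * k * (1 / (r - c)) = k / (r * (r - c)) := by field_simp
    rw [this, ← mul_div_assoc, div_le_div_iff₀ (by positivity) (by positivity)]
    nlinarith [mul_nonneg hk hr0.le, mul_nonneg (mul_nonneg hk hr0.le) (by linarith : 0 ≤ r - 6 * c)]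
  have key2 : k / r ^ 2 ≤ 1 / 2 := by
    rw [div_le_div_iff₀ (by positivity) (by positivity)]; linarith
  have key3 : 0 ≤ k / r ^ 2 := by positivity
  gcongr
  · nlinarith
  · calc _ ≤ _ := key
      _ ≤ _ := by rw [mul_div_assoc]; linarith

lemma enorm_exp_real (l : ℂ) (t : ℝ) :
    ‖Complex.exp (-(l * (t : ℂ)))‖ₑ = ENNReal.ofReal (Real.exp (-(l.re * t))) := by
  rw [← ofReal_norm, Complex.norm_exp]
  simp

lemma enorm_forward (l : ℂ) (p : ℝ → ℂ) {y : ℝ} (hy : 0 ≤ y) :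
    ‖∫ z in (0:ℝ)..y, Complex.exp (-(l * ((y - z : ℝ) : ℂ))) * p z‖ₑ
      ≤ ∫⁻ z in Ioi (0:ℝ), KB l.re z y * ‖p z‖ₑ := by
  rw [intervalIntegral.integral_of_le hy, integral_Ioc_eq_integral_Ioo]
  refine (enorm_integral_le_lintegral_enorm _).trans ?_
  calc ∫⁻ z in Ioo 0 y, ‖Complex.exp (-(l * ((y - z : ℝ) : ℂ))) * p z‖ₑ
      = ∫⁻ z in Ioo 0 y, KB l.re z y * ‖p z‖ₑ := by
        refine setLIntegral_congr_fun measurableSet_Ioo fun z hz => ?_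
        simp only [enorm_mul, enorm_exp_real, KB, if_pos hz.2]
    _ ≤ _ := lintegral_mono_set Ioo_subset_Ioi_self

lemma enorm_tail (l : ℂ) (h : ℝ → ℂ) {y : ℝ} (hy : 0 ≤ y) :
    ‖∫ z in Ioi y, Complex.exp (-(l * ((z - y : ℝ) : ℂ))) * h z‖ₑ
      ≤ ∫⁻ z in Ioi (0:ℝ), KB l.re y z * ‖h z‖ₑ := by
  refine (enorm_integral_le_lintegral_enorm _).trans ?_
  calc ∫⁻ z in Ioi y, ‖Complex.exp (-(l * ((z - y : ℝ) : ℂ))) * h z‖ₑ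
      = ∫⁻ z in Ioi y, KB l.re y z * ‖h z‖ₑ := by
        refine setLIntegral_congr_fun measurableSet_Ioi fun z hz => ?_
        simp only [enorm_mul, enorm_exp_real, KB, if_pos (show y < z from hz)]
    _ ≤ _ := lintegral_mono_set (Ioi_subset_Ioi hy)

lemma enorm_prim (v : ℝ → ℂ) {y : ℝ} (hy : 0 ≤ y) :
    ‖∫ z in (0:ℝ)..y, v z‖ₑ ≤ ∫⁻ z in Ioi (0:ℝ), KB 0 z y * ‖v z‖ₑ := by
  have := enorm_forward 0 v hy
  simpa using this

lemma bdd_of_tendsto (f : ℝ → ℂ) (L : ℂ) (hf : ContinuousOn f (Ici 0)) (hl : Tendsto f atTop (nhds L)) :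
    ∃ C, 0 ≤ C ∧ ∀ y, 0 ≤ y → ‖f y‖ ≤ C := by
  have h1 : ∀ᶠ y in atTop, ‖f y‖ < ‖L‖ + 1 := hl.norm.eventually (gt_mem_nhds (by linarith))
  obtain ⟨Y, hY⟩ := eventually_atTop.1 h1
  obtain ⟨C, hC⟩ := (isCompact_Icc (a := (0:ℝ)) (b := Y)).exists_bound_of_continuousOn
    (hf.mono Icc_subset_Ici_self)
  refine ⟨max C (‖L‖ + 1), le_max_of_le_right (by positivity), fun y hy => ?_⟩
  rcases le_total y Y with h | h
  · exact (hC y ⟨hy, h⟩).trans (le_max_left _ _)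
  · exact (hY y h).le.trans (le_max_right _ _)

lemma srcF_nonneg (hU : BasicFlow U M) {y : ℝ} (hy : 0 ≤ y) : 0 ≤ srcF U y := by
  have h1 := hU.le_one y hy
  have h2 := mul_nonneg hy (hU.d_nonneg y hy)
  unfold srcF; linarith

lemma srcF_le (hU : BasicFlow U M) {y : ℝ} (hy : 0 ≤ y) : srcF U y ≤ 1 + M * y := by
  have h1 := hU.nonneg y hy
  have h2 := mul_le_mul_of_nonneg_left (hU.d_le y hy) hy
  unfold srcF; linarith

lemma srcF_cont (hU : BasicFlow U M) : Continuous (srcF U) := by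
  have := hU.cont
  have := hU.dcont
  unfold srcF; fun_prop

/-- Right-hand side. -/
def hh (U : ℝ → ℝ) (φ v : ℝ → ℂ) (y : ℝ) : ℂ :=
  (U y : ℂ) * v y - ((deriv U y : ℝ) : ℂ) * φ y + (srcF U y : ℂ)

lemma hh_enorm_le (hU : BasicFlow U M) (φ v : ℝ → ℂ)
    (hφ : ∀ y, 0 ≤ y → φ y = ∫ z in (0:ℝ)..y, v z) (y : ℝ) (hy : 0 < y) :
    ‖hh U φ v y‖ₑ ≤ ‖v y‖ₑ + ENNReal.ofReal (deriv U y) *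
        (∫⁻ z in Ioi (0:ℝ), KB 0 z y * ‖v z‖ₑ) + ENNReal.ofReal (srcF U y) := by
  unfold hh
  have hd := hU.d_nonneg y hy.le
  have hF := srcF_nonneg hU hy.le
  refine (enorm_add_le _ _).trans ?_
  gcongr
  · refine (enorm_sub_le).trans ?_
    gcongr
    · rw [enorm_mul]
      calc ‖(U y : ℂ)‖ₑ * ‖v y‖ₑ ≤ 1 * ‖v y‖ₑ := by
            gcongr
            rw [← ofReal_norm, Complex.norm_real, Real.norm_of_nonneg (hU.nonneg y hy.le)]
            exact ENNReal.ofReal_le_one.2 (hU.le_one y hy.le)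
        _ = _ := one_mul _
    · rw [enorm_mul, hφ y hy.le]
      gcongr
      · rw [← ofReal_norm, Complex.norm_real, Real.norm_of_nonneg hd]
      · exact enorm_prim v hy.le
  · rw [← ofReal_norm, Complex.norm_real, Real.norm_of_nonneg hF]

/-- absorbing -/
lemma absorb {N A : ENNReal} (hN : N ≠ ⊤) (hA : A ≠ ⊤) (h : N ≤ A + ENNReal.ofReal (3/4) * N) :
    N ≤ ENNReal.ofReal 4 * A := by
  lift N to NNReal using hN
  lift A to NNReal using hA
  have e : ENNReal.ofReal (3/4) = ((3/4 : NNReal) : ENNReal) := by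
    rw [ENNReal.ofReal]; congr 1; ext; norm_num
  have e4 : ENNReal.ofReal 4 = ((4 : NNReal) : ENNReal) := by
    rw [ENNReal.ofReal]; congr 1; ext; norm_num
  rw [e] at h
  rw [e4]
  norm_cast at h ⊢
  have h' : (N : ℝ) ≤ A + 3/4 * N := by exact_mod_cast h
  have : (N : ℝ) ≤ 4 * A := by linarith
  exact_mod_cast this

lemma Wt_le_one (hU : BasicFlow U M) {δ y : ℝ} (hδ : 0 ≤ δ) (hy : 0 ≤ y) : Wt U δ y ≤ 1 := by
  unfold Wt
  apply ENNReal.ofReal_le_one.2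
  apply Real.exp_le_one_iff.2
  have := hU.nonneg y hy
  nlinarith [mul_nonneg hδ hy]

lemma lintegral_exp (r : ℝ) (hr : 0 < r) :
    ∫⁻ y in Ioi (0:ℝ), ENNReal.ofReal (Real.exp (-(r * y))) = ENNReal.ofReal (1 / r) := by
  have hr' : -r < 0 := by linarith
  have := integral_exp_mul_Ioi hr' 0
  have hi := integrableOn_exp_mul_Ioi hr' 0
  simp only [neg_mul] at this hi
  rw [← ofReal_integral_eq_lintegral_ofReal hi, this]
  · congr 1; simp
  · exact Eventually.of_forall fun y => by positivity

end

section
variable {U : ℝ → ℝ} {M : ℝ}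

/-- First order form of the problem. -/
structure Sol (U : ℝ → ℝ) (l : ℂ) (k : ℝ) (φ v w : ℝ → ℂ) : Prop where
  dφ : ∀ y, 0 ≤ y → HasDerivAt φ (v y) y
  dv : ∀ y, 0 ≤ y → HasDerivAt v (w y) y
  dw : ∀ y, 0 ≤ y → HasDerivAt w (l ^ 2 * v y + Complex.I * k * hh U φ v y) y
  φ0 : φ 0 = 0
  v0 : v 0 = 1

variable {l : ℂ} {k : ℝ} {φ v w : ℝ → ℂ} {L : ℂ}

lemma Sol.cφ (hS : Sol U l k φ v w) : ContinuousOn φ (Ici 0) :=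
  fun y hy => (hS.dφ y hy).continuousAt.continuousWithinAt
lemma Sol.cv (hS : Sol U l k φ v w) : ContinuousOn v (Ici 0) :=
  fun y hy => (hS.dv y hy).continuousAt.continuousWithinAt
lemma Sol.cw (hS : Sol U l k φ v w) : ContinuousOn w (Ici 0) :=
  fun y hy => (hS.dw y hy).continuousAt.continuousWithinAt
lemma Sol.ch (hS : Sol U l k φ v w) (hU : BasicFlow U M) : ContinuousOn (hh U φ v) (Ici 0) := by
  have h1 := hS.cφ
  have h2 := hS.cv
  have h3 : Continuous fun y => (U y : ℂ) := Complex.continuous_ofReal.comp hU.cont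
  have h4 : Continuous fun y => ((deriv U y : ℝ) : ℂ) := Complex.continuous_ofReal.comp hU.dcont
  have h5 : Continuous fun y => (srcF U y : ℂ) := Complex.continuous_ofReal.comp (srcF_cont hU)
  exact ((h3.continuousOn.mul h2).sub (h4.continuousOn.mul h1)).add h5.continuousOn

lemma Sol.φ_eq (hS : Sol U l k φ v w) (y : ℝ) (hy : 0 ≤ y) : φ y = ∫ z in (0:ℝ)..y, v z := by
  rw [intervalIntegral.integral_eq_sub_of_hasDerivAt (f := φ) (f' := v), hS.φ0, sub_zero]
  · intro x hx
    rw [uIcc_of_le hy] at hx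
    exact hS.dφ x hx.1
  · exact (hS.cv.mono (by rw [uIcc_of_le hy]; exact Icc_subset_Ici_self)).intervalIntegrable

lemma hh_bound (hU : BasicFlow U M) {φ v : ℝ → ℂ} {Cφ Cv : ℝ} (hCφ : ∀ y, 0 ≤ y → ‖φ y‖ ≤ Cφ)
    (hCv : ∀ y, 0 ≤ y → ‖v y‖ ≤ Cv) (h0 : 0 ≤ Cφ) (h1 : 0 ≤ Cv) (y : ℝ) (hy : 0 ≤ y) :
    ‖hh U φ v y‖ ≤ (Cv + M * Cφ + 1 + M) * (1 + y) := by
  have hM := hU.M_nonneg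
  have hd := hU.d_nonneg y hy
  have hd' := hU.d_le y hy
  have hu := hU.nonneg y hy
  have hu' := hU.le_one y hy
  have hF := srcF_nonneg hU hy
  have hF' := srcF_le hU hy
  have a1 : ‖(U y : ℂ) * v y‖ ≤ Cv := by
    rw [norm_mul, Complex.norm_real, Real.norm_of_nonneg hu]
    nlinarith [hCv y hy, norm_nonneg (v y)]
  have a2 : ‖((deriv U y : ℝ) : ℂ) * φ y‖ ≤ M * Cφ := by
    rw [norm_mul, Complex.norm_real, Real.norm_of_nonneg hd]
    exact mul_le_mul hd' (hCφ y hy) (norm_nonneg _) hM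
  have a3 : ‖(srcF U y : ℂ)‖ ≤ 1 + M * y := by
    rw [Complex.norm_real, Real.norm_of_nonneg hF]; exact hF'
  have a4 : ‖hh U φ v y‖ ≤ Cv + M * Cφ + (1 + M * y) := by
    unfold hh
    refine (norm_add_le _ _).trans (add_le_add ((norm_sub_le _ _).trans (add_le_add a1 a2)) a3)
  nlinarith [mul_nonneg hM h0, mul_nonneg (mul_nonneg hM h0) hy, mul_nonneg h1 hy, mul_nonneg hM hy]

lemma one_add_le_exp {y : ℝ} (_hy : 0 ≤ y) : 1 + y ≤ Real.exp y := by
  have := Real.add_one_le_exp y; linarith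

lemma norm_exp_real (l : ℂ) (t : ℝ) :
    ‖Complex.exp (-(l * (t : ℂ)))‖ = Real.exp (-(l.re * t)) := by
  rw [Complex.norm_exp]
  simp

lemma cexp_hasDerivAt (l : ℂ) (y : ℝ) :
    HasDerivAt (fun y : ℝ => Complex.exp (-(l * (y : ℂ)))) (-l * Complex.exp (-(l * (y : ℂ)))) y := by
  have h1 : HasDerivAt (fun y : ℝ => -(l * (y : ℂ))) (-l) y := by
    have := ((hasDerivAt_id y).ofReal_comp.const_mul l).neg
    refine (this.congr_deriv ?_)
    simp
  have := h1.cexp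
  refine this.congr_deriv ?_
  ring

lemma exp_hh_integrable (hU : BasicFlow U M) (hS : Sol U l k φ v w) (hl : 2 ≤ l.re)
    {C : ℝ} (hC : ∀ y, 0 ≤ y → ‖hh U φ v y‖ ≤ C * (1 + y)) :
    IntegrableOn (fun z : ℝ => Complex.exp (-(l * (z : ℂ))) * hh U φ v z) (Ioi 0) := by
  have hC0 : 0 ≤ C := by
    have := (norm_nonneg _).trans (hC 0 le_rfl); simpa using this
  have hi := (integrableOn_exp_mul_Ioi (a := -1) (by norm_num) 0).const_mul C
  refine Integrable.mono' hi ?_ ?_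
  · refine ContinuousOn.aestronglyMeasurable ?_ measurableSet_Ioi
    refine ContinuousOn.mul (by fun_prop) ((hS.ch hU).mono Ioi_subset_Ici_self)
  · refine (ae_restrict_iff' measurableSet_Ioi).2 (Eventually.of_forall fun z hz => ?_)
    have hz0 : 0 ≤ z := le_of_lt hz
    rw [norm_mul, norm_exp_real]
    calc Real.exp (-(l.re * z)) * ‖hh U φ v z‖
        ≤ Real.exp (-(2 * z)) * (C * Real.exp z) := by
          gcongr
          exact (hC z hz0).trans (mul_le_mul_of_nonneg_left (one_add_le_exp hz0) hC0)
      _ = C * Real.exp (-1 * z) := by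
          rw [mul_left_comm, ← Real.exp_add]; congr 2; ring

/-- Decay of `e^{-λ y} p(y)`. -/
lemma Sol.decay (hU : BasicFlow U M) (hS : Sol U l k φ v w) (hl : 3 ≤ l.re)
    {Cv C : ℝ} (hCv : ∀ y, 0 ≤ y → ‖v y‖ ≤ Cv)
    (hC : ∀ y, 0 ≤ y → ‖hh U φ v y‖ ≤ C * (1 + y)) :
    Tendsto (fun y : ℝ => Complex.exp (-(l * (y : ℂ))) * (w y + l * v y)) atTop (nhds 0) := by
  have hC0 : 0 ≤ C := by
    have := (norm_nonneg _).trans (hC 0 le_rfl); simpa using this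
  have hCv0 : 0 ≤ Cv := (norm_nonneg _).trans (hCv 0 le_rfl)
  set D := ‖l‖ ^ 2 * Cv + |k| * C with hD
  have hD0 : 0 ≤ D := by positivity
  have hw : ∀ y, 0 ≤ y → ‖w y‖ ≤ ‖w 0‖ + D * (1 + y) * y := by
    intro y hy
    have := norm_image_sub_le_of_norm_deriv_le_segment' (f := w)
      (f' := fun y => l ^ 2 * v y + Complex.I * k * hh U φ v y) (C := D * (1 + y)) (a := 0) (b := y)
      (fun x hx => (hS.dw x hx.1).hasDerivWithinAt) (fun x hx => ?_) y ⟨hy, le_rfl⟩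
    · have h2 := norm_le_norm_add_norm_sub' (w y) (w 0)
      rw [sub_zero] at this
      linarith
    · have hx0 := hx.1
      have hxy := hx.2.le
      calc ‖l ^ 2 * v x + Complex.I * k * hh U φ v x‖
          ≤ ‖l‖ ^ 2 * ‖v x‖ + |k| * ‖hh U φ v x‖ := by
            refine (norm_add_le _ _).trans ?_
            simp
        _ ≤ ‖l‖ ^ 2 * Cv + |k| * (C * (1 + y)) := by
            gcongr
            · exact hCv x hx0
            · exact (hC x hx0).trans (by gcongr)
        _ ≤ D * (1 + y) := by
            rw [hD]
            nlinarith [mul_nonneg (mul_nonneg (sq_nonneg ‖l‖) hCv0) hy]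
  have hlim : Tendsto (fun y : ℝ => (‖w 0‖ + D + ‖l‖ * Cv) * Real.exp (-y)) atTop (nhds 0) := by
    have := Real.tendsto_exp_neg_atTop_nhds_zero.const_mul (‖w 0‖ + D + ‖l‖ * Cv)
    simpa using this
  refine squeeze_zero_norm' ?_ hlim
  filter_upwards [eventually_ge_atTop (0:ℝ)] with y hy
  rw [norm_mul, norm_exp_real]
  have e1 := one_add_le_exp hy
  have e2 : 1 ≤ Real.exp y := by linarith
  have e3 : 1 ≤ Real.exp y * Real.exp y := by nlinarith
  calc Real.exp (-(l.re * y)) * ‖w y + l * v y‖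
      ≤ Real.exp (-(3 * y)) * ((‖w 0‖ + D + ‖l‖ * Cv) * (Real.exp y * Real.exp y)) := by
        gcongr
        calc ‖w y + l * v y‖ ≤ ‖w y‖ + ‖l‖ * ‖v y‖ := by
              refine (norm_add_le _ _).trans ?_
              rw [norm_mul]
          _ ≤ (‖w 0‖ + D * (1 + y) * y) + ‖l‖ * Cv := by
              gcongr
              · exact hw y hy
              · exact hCv y hy
          _ ≤ (‖w 0‖ + D * (Real.exp y * Real.exp y)) + ‖l‖ * Cv := by
              rw [mul_assoc]
              gcongr
              linarith
          _ ≤ _ := by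
              have := norm_nonneg (w 0)
              have := mul_nonneg (norm_nonneg l) hCv0
              nlinarith
    _ = _ := by
        rw [mul_left_comm, ← Real.exp_add, ← Real.exp_add]; congr 2; ring

lemma Sol.p_eq (hU : BasicFlow U M) (hS : Sol U l k φ v w) (hl : 3 ≤ l.re)
    {Cv C : ℝ} (hCv : ∀ y, 0 ≤ y → ‖v y‖ ≤ Cv)
    (hC : ∀ y, 0 ≤ y → ‖hh U φ v y‖ ≤ C * (1 + y)) (y : ℝ) (hy : 0 ≤ y) :
    w y + l * v y = -(Complex.I * k) *
      ∫ z in Ioi y, Complex.exp (-(l * ((z - y : ℝ) : ℂ))) * hh U φ v z := by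
  have hi := (exp_hh_integrable hU hS (by linarith) hC).mono_set (Ioi_subset_Ioi hy)
  have hd : ∀ x ∈ Ici y, HasDerivAt
      (fun y : ℝ => Complex.exp (-(l * (y : ℂ))) * (w y + l * v y))
      (Complex.I * k * (Complex.exp (-(l * (x : ℂ))) * hh U φ v x)) x := by
    intro x hx
    have hx0 : 0 ≤ x := hy.trans hx
    have := (cexp_hasDerivAt l x).mul ((hS.dw x hx0).add ((hS.dv x hx0).const_mul l))
    refine this.congr_deriv ?_
    simp only [Pi.add_apply]
    ring
  have he := integral_Ioi_of_hasDerivAt_of_tendsto' hd (hi.const_mul _) (hS.decay hU hl hCv hC)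
  rw [integral_const_mul] at he
  have hs : ∫ z in Ioi y, Complex.exp (-(l * ((z - y : ℝ) : ℂ))) * hh U φ v z =
      Complex.exp (l * y) * ∫ z in Ioi y, Complex.exp (-(l * (z : ℂ))) * hh U φ v z := by
    rw [← integral_const_mul]
    congr 1; ext z
    rw [← mul_assoc, ← Complex.exp_add]
    congr 2; push_cast; ring
  rw [hs, mul_left_comm, neg_mul, he, zero_sub, neg_neg, ← mul_assoc, ← Complex.exp_add]
  simp

lemma Sol.v_eq (hS : Sol U l k φ v w) (y : ℝ) (hy : 0 ≤ y) :
    v y = Complex.exp (-(l * (y : ℂ))) +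
      ∫ z in (0:ℝ)..y, Complex.exp (-(l * ((y - z : ℝ) : ℂ))) * (w z + l * v z) := by
  have hd : ∀ x ∈ uIcc 0 y, HasDerivAt
      (fun z : ℝ => Complex.exp (-(l * ((y - z : ℝ) : ℂ))) * v z)
      (Complex.exp (-(l * ((y - x : ℝ) : ℂ))) * (w x + l * v x)) x := by
    intro x hx
    rw [uIcc_of_le hy] at hx
    have h1 : HasDerivAt (fun z : ℝ => Complex.exp (-(l * ((y - z : ℝ) : ℂ))))
        (l * Complex.exp (-(l * ((y - x : ℝ) : ℂ)))) x := by
      have := (cexp_hasDerivAt l (y - x)).scomp x ((hasDerivAt_id x).const_sub y)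
      refine this.congr_deriv ?_
      simp
    refine (h1.mul (hS.dv x hx.1)).congr_deriv ?_
    ring
  rw [intervalIntegral.integral_eq_sub_of_hasDerivAt hd]
  · simp [hS.v0]
  · refine ContinuousOn.intervalIntegrable ?_
    rw [uIcc_of_le hy]
    refine ContinuousOn.mul (by fun_prop) ?_
    exact ((hS.cw.add (continuousOn_const.mul hS.cv))).mono Icc_subset_Ici_self

lemma aem_of_contOn {f : ℝ → ℂ} (hf : ContinuousOn f (Ici 0)) :
    AEMeasurable (fun y => ‖f y‖ₑ) (volume.restrict (Ioi 0)) :=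
  ((hf.mono Ioi_subset_Ici_self).aestronglyMeasurable measurableSet_Ioi).enorm

lemma Sol.weighted (hU : BasicFlow U M) (hS : Sol U l k φ v w) (hl : 6 * (4 * M + 1) ≤ l.re)
    (hk : 0 ≤ k) (hkr : 2 * k ≤ l.re ^ 2)
    {Cv C : ℝ} (hCv : ∀ y, 0 ≤ y → ‖v y‖ ≤ Cv)
    (hC : ∀ y, 0 ≤ y → ‖hh U φ v y‖ ≤ C * (1 + y)) {δ : ℝ} (hδ : 0 < δ) (hδ1 : δ ≤ 1) :
    ∫⁻ y in Ioi (0:ℝ), Wt U δ y * ‖v y‖ₑ ≤ ENNReal.ofReal (4 *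
      (1 / l.re + 2 * k / l.re ^ 2 * ∫ y in Ioi (0:ℝ), srcF U y)) := by
  have hM := hU.M_nonneg
  have hr0 : 0 < l.re := by linarith
  have hFi : 0 ≤ ∫ y in Ioi (0:ℝ), srcF U y :=
    setIntegral_nonneg measurableSet_Ioi fun y hy => srcF_nonneg hU (le_of_lt hy)
  have hp : ContinuousOn (fun y => w y + l * v y) (Ici 0) := hS.cw.add (continuousOn_const.mul hS.cv)
  have hc := chain2 hU hδ.le hδ1 hl hk hkr (fun y => ‖v y‖ₑ) (fun y => ‖v y‖ₑ)
    (fun y => ‖w y + l * v y‖ₑ) (fun y => ‖hh U φ v y‖ₑ)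
    (fun y => ENNReal.ofReal (Real.exp (-(l.re * y)))) (fun y => ENNReal.ofReal (srcF U y))
    (aem_of_contOn hS.cv) (aem_of_contOn hp) (aem_of_contOn (hS.ch hU))
    (by fun_prop)
    (fun y hy => ?_) (fun y hy => ?_) (hh_enorm_le hU φ v hS.φ_eq)
  · have hA : (∫⁻ y in Ioi (0:ℝ), Wt U δ y * ENNReal.ofReal (Real.exp (-(l.re * y)))) ≤
        ENNReal.ofReal (1 / l.re) := by
      rw [← lintegral_exp _ hr0]
      refine setLIntegral_mono' measurableSet_Ioi fun y hy => ?_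
      exact mul_le_of_le_one_left zero_le (Wt_le_one hU hδ.le (le_of_lt hy))
    have hB : (∫⁻ y in Ioi (0:ℝ), Wt U δ y * ENNReal.ofReal (srcF U y)) ≤
        ENNReal.ofReal (∫ y in Ioi (0:ℝ), srcF U y) := by
      rw [ofReal_integral_eq_lintegral_ofReal hU.F_int]
      · refine setLIntegral_mono' measurableSet_Ioi fun y hy => ?_
        exact mul_le_of_le_one_left zero_le (Wt_le_one hU hδ.le (le_of_lt hy))
      · exact (ae_restrict_iff' measurableSet_Ioi).2 (Eventually.of_forall fun y hy =>
          srcF_nonneg hU (le_of_lt hy))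
    have hN : (∫⁻ y in Ioi (0:ℝ), Wt U δ y * ‖v y‖ₑ) ≠ ⊤ := by
      refine ne_top_of_le_ne_top (b := (ENNReal.ofReal (1/δ) * ENNReal.ofReal Cv)) ?_ ?_
      · exact ENNReal.mul_ne_top ENNReal.ofReal_ne_top ENNReal.ofReal_ne_top
      · rw [← lintegral_exp δ hδ, ← lintegral_mul_const' _ _ ENNReal.ofReal_ne_top]
        refine setLIntegral_mono' measurableSet_Ioi fun y hy => ?_
        have hy0 : 0 ≤ y := le_of_lt hy
        gcongr
        · unfold Wt
          apply ENNReal.ofReal_le_ofReal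
          apply Real.exp_le_exp.2
          have := hU.nonneg y hy0
          linarith
        · rw [← ofReal_norm]
          exact ENNReal.ofReal_le_ofReal (hCv y hy0)
    have h4 := absorb hN (A := ENNReal.ofReal (1 / l.re) + ENNReal.ofReal (2 * k / l.re ^ 2) *
      ENNReal.ofReal (∫ y in Ioi (0:ℝ), srcF U y)) (by finiteness) ?_
    · refine h4.trans (le_of_eq ?_)
      rw [← ENNReal.ofReal_mul (by positivity), ← ENNReal.ofReal_add (by positivity) (by positivity),
        ← ENNReal.ofReal_mul (by positivity)]
    · refine hc.trans ?_
      rw [add_assoc, add_comm (ENNReal.ofReal (2 * k / l.re ^ 2) * _)]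
      gcongr
  · rw [← enorm_exp_real]
    conv_lhs => rw [hS.v_eq y hy.le]
    refine (enorm_add_le _ _).trans ?_
    gcongr
    exact enorm_forward l _ hy.le
  · rw [hS.p_eq hU (by linarith) hCv hC y hy.le, enorm_mul]
    gcongr
    · rw [← ofReal_norm]
      simp [abs_of_nonneg hk]
    · exact enorm_tail l _ hy.le

end

section
variable {U : ℝ → ℝ} {M : ℝ}
variable {l : ℂ} {k : ℝ} {φ v w : ℝ → ℂ} {L : ℂ}

lemma Wt_zero_ge (hU : BasicFlow U M) {y : ℝ} (hy : 0 ≤ y) :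
    ENNReal.ofReal (Real.exp (-4)) ≤ Wt U 0 y := by
  unfold Wt
  apply ENNReal.ofReal_le_ofReal
  apply Real.exp_le_exp.2
  have := hU.le_one y hy
  linarith

lemma l1_of_weight (hU : BasicFlow U M) (v : ℝ → ENNReal) {R : ℝ}
    (hR : ∫⁻ y in Ioi (0:ℝ), Wt U 0 y * v y ≤ ENNReal.ofReal R) :
    ∫⁻ y in Ioi (0:ℝ), v y ≤ ENNReal.ofReal (Real.exp 4 * R) := by
  calc ∫⁻ y in Ioi (0:ℝ), v y
      ≤ ∫⁻ y in Ioi (0:ℝ), ENNReal.ofReal (Real.exp 4) * (Wt U 0 y * v y) := by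
        refine setLIntegral_mono' measurableSet_Ioi fun y hy => ?_
        rw [← mul_assoc]
        calc v y = 1 * v y := (one_mul _).symm
          _ ≤ _ := by
            gcongr
            calc (1 : ENNReal) = ENNReal.ofReal (Real.exp 4) * ENNReal.ofReal (Real.exp (-4)) := by
                  rw [← ENNReal.ofReal_mul (by positivity), ← Real.exp_add]; simp
              _ ≤ _ := by
                  gcongr
                  exact Wt_zero_ge hU (le_of_lt hy)
    _ = ENNReal.ofReal (Real.exp 4) * ∫⁻ y in Ioi (0:ℝ), (Wt U 0 y * v y) :=
        lintegral_const_mul' _ _ ENNReal.ofReal_ne_top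
    _ ≤ _ := by
        rw [ENNReal.ofReal_mul (by positivity)]
        gcongr

lemma Sol.l1 (hU : BasicFlow U M) (hS : Sol U l k φ v w) (hl : 6 * (4 * M + 1) ≤ l.re)
    (hk : 0 ≤ k) (hkr : 2 * k ≤ l.re ^ 2)
    {Cv C : ℝ} (hCv : ∀ y, 0 ≤ y → ‖v y‖ ≤ Cv)
    (hC : ∀ y, 0 ≤ y → ‖hh U φ v y‖ ≤ C * (1 + y)) :
    ∫⁻ y in Ioi (0:ℝ), ‖v y‖ₑ ≤ ENNReal.ofReal (Real.exp 4 * (4 *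
      (1 / l.re + 2 * k / l.re ^ 2 * ∫ y in Ioi (0:ℝ), srcF U y))) := by
  apply l1_of_weight hU
  have h1 : ∀ n : ℕ, ∫⁻ y in Ioi (0:ℝ), Wt U (1 / ((n:ℝ) + 1)) y * ‖v y‖ₑ ≤ ENNReal.ofReal (4 *
      (1 / l.re + 2 * k / l.re ^ 2 * ∫ y in Ioi (0:ℝ), srcF U y)) := fun n =>
    hS.weighted hU hl hk hkr hCv hC (by positivity)
      (by rw [div_le_one (by positivity)]; linarith [(Nat.cast_nonneg n : (0:ℝ) ≤ n)])
  have h2 : ∀ y, Tendsto (fun n : ℕ => Wt U (1 / ((n:ℝ) + 1)) y * ‖v y‖ₑ) atTop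
      (nhds (Wt U 0 y * ‖v y‖ₑ)) := by
    intro y
    refine ENNReal.Tendsto.mul_const ?_ (Or.inr enorm_ne_top)
    unfold Wt
    refine (ENNReal.continuous_ofReal.tendsto _).comp ((Real.continuous_exp.tendsto _).comp ?_)
    refine Tendsto.neg (Tendsto.const_add _ ?_)
    exact tendsto_one_div_add_atTop_nhds_zero_nat.mul_const y
  calc ∫⁻ y in Ioi (0:ℝ), Wt U 0 y * ‖v y‖ₑ
      = ∫⁻ y in Ioi (0:ℝ), liminf (fun n : ℕ => Wt U (1 / ((n:ℝ) + 1)) y * ‖v y‖ₑ) atTop :=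
        lintegral_congr fun y => (h2 y).liminf_eq.symm
    _ ≤ liminf (fun n : ℕ => ∫⁻ y in Ioi (0:ℝ), Wt U (1 / ((n:ℝ) + 1)) y * ‖v y‖ₑ) atTop :=
        lintegral_liminf_le' fun n => (measurable_Wt hU _).aemeasurable.mul (aem_of_contOn hS.cv)
    _ ≤ _ := by
        refine liminf_le_of_frequently_le' (Frequently.of_forall h1)

lemma deriv_integrable (hU : BasicFlow U M) : IntegrableOn (deriv U) (Ioi 0) ∧
    ∫ y in Ioi (0:ℝ), deriv U y ≤ 1 := by
  have hd : ∀ x ∈ Ici (0:ℝ), HasDerivAt U (deriv U x) x := fun x _ => (hU.diff x).hasDerivAt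
  have hp : ∀ x ∈ Ioi (0:ℝ), 0 ≤ deriv U x := fun x hx => hU.d_nonneg x (le_of_lt hx)
  refine ⟨integrableOn_Ioi_deriv_of_nonneg' hd hp hU.lim, ?_⟩
  rw [integral_Ioi_of_hasDerivAt_of_nonneg' hd hp hU.lim]
  linarith [hU.nonneg 0 le_rfl]

/-- `h` minus the source. -/
def h0 (U : ℝ → ℝ) (φ v : ℝ → ℂ) (y : ℝ) : ℂ :=
  (U y : ℂ) * v y - ((deriv U y : ℝ) : ℂ) * φ y

lemma h0_int (hU : BasicFlow U M) (hvm : AEStronglyMeasurable v (volume.restrict (Ioi 0)))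
    (hφm : AEStronglyMeasurable φ (volume.restrict (Ioi 0)))
    (hφ : ∀ y, 0 ≤ y → φ y = ∫ z in (0:ℝ)..y, v z)
    (hv : IntegrableOn v (Ioi 0)) :
    IntegrableOn (h0 U φ v) (Ioi 0) ∧
    ∫ y in Ioi (0:ℝ), ‖h0 U φ v y‖ ≤ 2 * ∫ y in Ioi (0:ℝ), ‖v y‖ := by
  set V := ∫ y in Ioi (0:ℝ), ‖v y‖ with hV
  have hV0 : 0 ≤ V := by positivity
  obtain ⟨hdi, hd1⟩ := deriv_integrable hU
  have hφV : ∀ y, 0 ≤ y → ‖φ y‖ ≤ V := by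
    intro y hy
    rw [hφ y hy, intervalIntegral.integral_of_le hy]
    refine (norm_integral_le_integral_norm _).trans ?_
    exact setIntegral_mono_set hv.norm (Eventually.of_forall fun _ => norm_nonneg _)
      Ioc_subset_Ioi_self.eventuallyLE
  have hb : ∀ y ∈ Ioi (0:ℝ), ‖h0 U φ v y‖ ≤ ‖v y‖ + deriv U y * V := by
    intro y hy
    have hy0 : 0 ≤ y := le_of_lt hy
    unfold h0
    refine (norm_sub_le _ _).trans ?_
    have hu := hU.nonneg y hy0
    have hu' := hU.le_one y hy0
    have hd := hU.d_nonneg y hy0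
    rw [norm_mul, norm_mul, Complex.norm_real, Complex.norm_real, Real.norm_of_nonneg hu,
      Real.norm_of_nonneg hd]
    gcongr
    · exact mul_le_of_le_one_left (norm_nonneg _) hu'
    · exact hφV y hy0
  have hbi : IntegrableOn (fun y => ‖v y‖ + deriv U y * V) (Ioi 0) := hv.norm.add (hdi.mul_const V)
  have h3 : Continuous fun y => (U y : ℂ) := Complex.continuous_ofReal.comp hU.cont
  have h4 : Continuous fun y => ((deriv U y : ℝ) : ℂ) := Complex.continuous_ofReal.comp hU.dcont
  have hi : IntegrableOn (h0 U φ v) (Ioi 0) := by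
    refine Integrable.mono' hbi ?_ ((ae_restrict_iff' measurableSet_Ioi).2 (Eventually.of_forall hb))
    exact (h3.aestronglyMeasurable.mul hvm).sub (h4.aestronglyMeasurable.mul hφm)
  refine ⟨hi, ?_⟩
  calc ∫ y in Ioi (0:ℝ), ‖h0 U φ v y‖ ≤ ∫ y in Ioi (0:ℝ), (‖v y‖ + deriv U y * V) :=
        setIntegral_mono_on hi.norm hbi measurableSet_Ioi hb
    _ = V + (∫ y in Ioi (0:ℝ), deriv U y) * V := by
        rw [integral_add hv.norm (hdi.mul_const V), integral_mul_const]
    _ ≤ 2 * V := by nlinarith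

lemma Sol.estimate (hU : BasicFlow U M) (hS : Sol U l k φ v w) (hl : 6 * (4 * M + 1) ≤ l.re)
    (hk : 0 ≤ k) (hkr : 2 * k ≤ l.re ^ 2)
    (hv : Tendsto v atTop (nhds 0)) (hφ : Tendsto φ atTop (nhds L)) :
    ‖l ^ 2 * L - (l - Complex.I * k * (2 * deltaS U))‖ ≤
      k * (4 * (Real.exp 4 * (4 * (1 / l.re + 2 * k / l.re ^ 2 * (2 * deltaS U))))
        + 2 * (1 + M) / l.re) := by
  have hM := hU.M_nonneg
  have hr0 : 0 < l.re := by linarith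
  obtain ⟨Cφ, hCφ0, hCφ⟩ := bdd_of_tendsto φ L hS.cφ hφ
  obtain ⟨Cv, hCv0, hCv⟩ := bdd_of_tendsto v 0 hS.cv hv
  have hC := hh_bound hU hCφ hCv hCφ0 hCv0
  have hFnn : 0 ≤ ∫ y in Ioi (0:ℝ), srcF U y :=
    setIntegral_nonneg measurableSet_Ioi fun y hy => srcF_nonneg hU (le_of_lt hy)
  have hl1 := hS.l1 hU hl hk hkr hCv hC
  set R := Real.exp 4 * (4 * (1 / l.re + 2 * k / l.re ^ 2 * ∫ y in Ioi (0:ℝ), srcF U y)) with hRdef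
  have hR0 : 0 ≤ R := by positivity
  have hvm : AEStronglyMeasurable v (volume.restrict (Ioi 0)) :=
    (hS.cv.mono Ioi_subset_Ici_self).aestronglyMeasurable measurableSet_Ioi
  have hφm : AEStronglyMeasurable φ (volume.restrict (Ioi 0)) :=
    (hS.cφ.mono Ioi_subset_Ici_self).aestronglyMeasurable measurableSet_Ioi
  have hvi : IntegrableOn v (Ioi 0) :=
    ⟨hvm, lt_of_le_of_lt hl1 ENNReal.ofReal_lt_top⟩
  have hV : ∫ y in Ioi (0:ℝ), ‖v y‖ ≤ R := by
    rw [integral_norm_eq_lintegral_enorm hvm]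
    exact ENNReal.toReal_le_of_le_ofReal hR0 hl1
  obtain ⟨h0i, h0le⟩ := h0_int hU hvm hφm hS.φ_eq hvi
  have hFi : IntegrableOn (fun y => (srcF U y : ℂ)) (Ioi 0) := hU.F_int.ofReal
  have hhi : IntegrableOn (hh U φ v) (Ioi 0) := h0i.add hFi
  have hhn : IntegrableOn (fun z => ‖hh U φ v z‖) (Ioi 0) := hhi.norm
  have hw : Tendsto w atTop (nhds 0) := by
    have ht : Tendsto (fun y => k * ((∫ z in Ioi (0:ℝ), ‖hh U φ v z‖) -
        ∫ z in (0:ℝ)..y, ‖hh U φ v z‖)) atTop (nhds 0) := by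
      have := ((intervalIntegral_tendsto_integral_Ioi 0 hhn tendsto_id).const_sub
        (∫ z in Ioi (0:ℝ), ‖hh U φ v z‖)).const_mul k
      simpa using this
    have hp : Tendsto (fun y => w y + l * v y) atTop (nhds 0) := by
      refine squeeze_zero_norm' ?_ ht
      filter_upwards [eventually_ge_atTop (0:ℝ)] with y hy
      have hiy := hhn.mono_set (Ioi_subset_Ioi hy)
      have e : (∫ z in Ioi (0:ℝ), ‖hh U φ v z‖) - ∫ z in (0:ℝ)..y, ‖hh U φ v z‖ =
          ∫ z in Ioi y, ‖hh U φ v z‖ := by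
        rw [← intervalIntegral.integral_Ioi_sub_Ioi hhn hy]; ring
      rw [e, hS.p_eq hU (by linarith) hCv hC y hy, norm_mul]
      have hk' : ‖-(Complex.I * (k:ℂ))‖ = k := by simp [abs_of_nonneg hk]
      rw [hk']
      gcongr
      refine norm_integral_le_of_norm_le hiy ?_
      refine (ae_restrict_iff' measurableSet_Ioi).2 (Eventually.of_forall fun z hz => ?_)
      rw [norm_mul, norm_exp_real]
      refine mul_le_of_le_one_left (norm_nonneg _) (Real.exp_le_one_iff.2 ?_)
      have : 0 ≤ z - y := sub_nonneg.2 (le_of_lt hz)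
      nlinarith
    have := hp.sub (hv.const_mul l)
    simpa using this
  have hφi : ∫ y in Ioi (0:ℝ), v y = L := by
    rw [integral_Ioi_of_hasDerivAt_of_tendsto' (f := φ) (fun x hx => hS.dφ x hx) hvi hφ, hS.φ0, sub_zero]
  have hwi := integral_Ioi_of_hasDerivAt_of_tendsto' (f := w) (fun x hx => hS.dw x hx)
    ((hvi.const_mul (l^2)).add (hhi.const_mul (Complex.I * k))) hw
  rw [integral_add (hvi.const_mul (l^2)) (hhi.const_mul (Complex.I * k)), integral_const_mul,
    integral_const_mul, hφi] at hwi
  have hp0 := hS.p_eq hU (by linarith) hCv hC 0 le_rfl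
  rw [hS.v0] at hp0
  simp only [sub_zero] at hp0
  have hexp : ∀ z ∈ Ioi (0:ℝ), ‖Complex.exp (-(l * (z:ℂ)))‖ ≤ 1 := by
    intro z hz
    rw [norm_exp_real]
    refine Real.exp_le_one_iff.2 ?_
    have : 0 < z := hz
    have := mul_pos hr0 this
    linarith
  have hem : AEStronglyMeasurable (fun z : ℝ => Complex.exp (-(l * (z:ℂ)))) (volume.restrict (Ioi 0)) :=
    Continuous.aestronglyMeasurable (by fun_prop)
  have hexpae : ∀ᵐ z : ℝ ∂(volume.restrict (Ioi (0:ℝ))), ‖Complex.exp (-(l * (z:ℂ)))‖ ≤ 1 :=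
    (ae_restrict_iff' measurableSet_Ioi).2 (Eventually.of_forall hexp)
  have hei0 : IntegrableOn (fun z : ℝ => Complex.exp (-(l * (z:ℂ))) * h0 U φ v z) (Ioi 0) :=
    h0i.bdd_mul hem hexpae
  have heiF : IntegrableOn (fun z : ℝ => Complex.exp (-(l * (z:ℂ))) * (srcF U z : ℂ)) (Ioi 0) :=
    hFi.bdd_mul hem hexpae
  have s1 : ∫ z in Ioi (0:ℝ), hh U φ v z = (∫ z in Ioi (0:ℝ), h0 U φ v z) + 2 * deltaS U := by
    have : ∫ z in Ioi (0:ℝ), hh U φ v z = (∫ z in Ioi (0:ℝ), h0 U φ v z) +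
      ∫ z in Ioi (0:ℝ), (srcF U z : ℂ) := integral_add h0i hFi
    rw [this, integral_complex_ofReal, hU.F_eq]
    push_cast; rfl
  have s2 : ∫ z in Ioi (0:ℝ), Complex.exp (-(l * (z:ℂ))) * hh U φ v z =
      (∫ z in Ioi (0:ℝ), Complex.exp (-(l * (z:ℂ))) * h0 U φ v z) +
      ∫ z in Ioi (0:ℝ), Complex.exp (-(l * (z:ℂ))) * (srcF U z : ℂ) := by
    rw [← integral_add hei0 heiF]
    congr 1; ext z
    unfold hh h0; ring
  set I1 := ∫ z in Ioi (0:ℝ), h0 U φ v z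
  set I2 := ∫ z in Ioi (0:ℝ), Complex.exp (-(l * (z:ℂ))) * h0 U φ v z
  set I3 := ∫ z in Ioi (0:ℝ), Complex.exp (-(l * (z:ℂ))) * (srcF U z : ℂ)
  have n1 : ‖I1‖ ≤ 2 * R := (norm_integral_le_integral_norm _).trans (h0le.trans (by linarith))
  have n2 : ‖I2‖ ≤ 2 * R := by
    refine (norm_integral_le_of_norm_le h0i.norm ?_).trans (h0le.trans (by linarith))
    filter_upwards [hexpae] with z hz
    rw [norm_mul]
    exact mul_le_of_le_one_left (norm_nonneg _) hz
  have n3 : ‖I3‖ ≤ 2 * (1 + M) / l.re := by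
    have hneg : -(l.re - 1) < 0 := by linarith
    have hi := (integrableOn_exp_mul_Ioi hneg 0).const_mul (1 + M)
    refine (norm_integral_le_of_norm_le hi ?_).trans ?_
    · refine (ae_restrict_iff' measurableSet_Ioi).2 (Eventually.of_forall fun z hz => ?_)
      have hz0 : 0 ≤ z := le_of_lt hz
      rw [norm_mul, norm_exp_real, Complex.norm_real, Real.norm_of_nonneg (srcF_nonneg hU hz0)]
      calc Real.exp (-(l.re * z)) * srcF U z ≤ Real.exp (-(l.re * z)) * ((1 + M) * Real.exp z) := by
            gcongr
            refine (srcF_le hU hz0).trans ?_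
            have := one_add_le_exp hz0
            have h5 : (1 + M) * (1 + z) ≤ (1 + M) * Real.exp z := by gcongr
            nlinarith
        _ = _ := by
            rw [mul_left_comm, ← Real.exp_add]; congr 2; ring
    · rw [integral_const_mul, integral_exp_mul_Ioi hneg]
      simp only [mul_zero, Real.exp_zero, neg_div_neg_eq]
      rw [mul_one_div, div_le_div_iff₀ (by linarith) hr0]
      nlinarith
  have key : l ^ 2 * L - (l - Complex.I * k * (2 * deltaS U)) = Complex.I * k * (I2 - I1 + I3) := by
    rw [s1] at hwi
    rw [s2] at hp0
    linear_combination hwi - hp0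
  rw [key, norm_mul]
  have hk' : ‖(Complex.I * (k:ℂ))‖ = k := by simp [abs_of_nonneg hk]
  rw [hk', ← hU.F_eq, ← hRdef]
  gcongr
  calc ‖I2 - I1 + I3‖ ≤ ‖I2‖ + ‖I1‖ + ‖I3‖ :=
        (norm_add_le _ _).trans (by gcongr; exact norm_sub_le _ _)
    _ ≤ _ := by linarith

end

section
variable {U : ℝ → ℝ} {M : ℝ} {l : ℂ} {k : ℝ} {f g : ℝ → ℂ}

/-- Primitive. -/
def PhiOp (f : ℝ → ℂ) (y : ℝ) : ℂ := ∫ z in (0:ℝ)..y, f z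

/-- Backward part. -/
def pOp (U : ℝ → ℝ) (l : ℂ) (k : ℝ) (f : ℝ → ℂ) (y : ℝ) : ℂ :=
  -(Complex.I * k) * ∫ z in Ioi y, Complex.exp (-(l * ((z - y : ℝ) : ℂ))) * hh U (PhiOp f) f z

/-- The fixed point map. -/
def TOp (U : ℝ → ℝ) (l : ℂ) (k : ℝ) (f : ℝ → ℂ) (y : ℝ) : ℂ :=
  Complex.exp (-(l * (y : ℂ))) +
    ∫ z in (0:ℝ)..y, Complex.exp (-(l * ((y - z : ℝ) : ℂ))) * pOp U l k f z

lemma intervalIntegrable_of_Ioi (hf : IntegrableOn f (Ioi 0)) {a b : ℝ} (ha : 0 ≤ a) (hb : 0 ≤ b) :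
    IntervalIntegrable f volume a b := by
  rw [intervalIntegrable_iff]
  refine hf.mono_set fun x hx => ?_
  exact lt_of_le_of_lt (le_min ha hb) hx.1

lemma prim_contOn (hf : IntegrableOn f (Ioi 0)) : ContinuousOn (PhiOp f) (Ici 0) := by
  intro y hy
  have h : IntegrableOn f (uIcc 0 (y + 1)) := by
    rw [uIcc_of_le (by linarith [show (0:ℝ) ≤ y from hy]), integrableOn_Icc_iff_integrableOn_Ioc]
    exact hf.mono_set Ioc_subset_Ioi_self
  have := intervalIntegral.continuousOn_primitive_interval h
  rw [uIcc_of_le (by linarith [show (0:ℝ) ≤ y from hy])] at this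
  have h2 := this y ⟨hy, by linarith⟩
  refine h2.mono_of_mem_nhdsWithin ?_
  have : Iio (y + 1) ∈ nhds y := Iio_mem_nhds (by linarith)
  filter_upwards [self_mem_nhdsWithin, mem_nhdsWithin_of_mem_nhds this] with x hx hx'
  exact ⟨hx, le_of_lt hx'⟩

lemma aesm_of_contOn (hf : ContinuousOn f (Ici 0)) :
    AEStronglyMeasurable f (volume.restrict (Ioi 0)) :=
  (hf.mono Ioi_subset_Ici_self).aestronglyMeasurable measurableSet_Ioi

lemma hhOp_int (hU : BasicFlow U M) (hf : IntegrableOn f (Ioi 0)) :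
    IntegrableOn (hh U (PhiOp f) f) (Ioi 0) := by
  have hFi : IntegrableOn (fun y => (srcF U y : ℂ)) (Ioi 0) := hU.F_int.ofReal
  exact (h0_int hU hf.1 (aesm_of_contOn (prim_contOn hf)) (fun _ _ => rfl) hf).1.add hFi

lemma exp_mul_int (hl : 0 ≤ l.re) (hf : IntegrableOn f (Ioi 0)) :
    IntegrableOn (fun z : ℝ => Complex.exp (-(l * (z : ℂ))) * f z) (Ioi 0) := by
  have hem : AEStronglyMeasurable (fun z : ℝ => Complex.exp (-(l * (z:ℂ)))) (volume.restrict (Ioi 0)) :=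
    Continuous.aestronglyMeasurable (by fun_prop)
  refine hf.bdd_mul (c := 1) hem ((ae_restrict_iff' measurableSet_Ioi).2 (Eventually.of_forall ?_))
  intro z hz
  rw [norm_exp_real]
  refine Real.exp_le_one_iff.2 ?_
  have := mul_nonneg hl (le_of_lt hz)
  linarith

lemma pOp_eq (hU : BasicFlow U M) (hl : 0 ≤ l.re) (hf : IntegrableOn f (Ioi 0)) {y : ℝ} (hy : 0 ≤ y) :
    pOp U l k f y = -(Complex.I * k) * (Complex.exp (l * y) *
      ((∫ z in Ioi (0:ℝ), Complex.exp (-(l * (z : ℂ))) * hh U (PhiOp f) f z) -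
        PhiOp (fun z => Complex.exp (-(l * (z : ℂ))) * hh U (PhiOp f) f z) y)) := by
  have hi := exp_mul_int hl (hhOp_int hU hf)
  unfold pOp
  congr 1
  have e := intervalIntegral.integral_Ioi_sub_Ioi hi hy
  have e' : (∫ z in Ioi (0:ℝ), Complex.exp (-(l * (z : ℂ))) * hh U (PhiOp f) f z) -
        PhiOp (fun z => Complex.exp (-(l * (z : ℂ))) * hh U (PhiOp f) f z) y =
      ∫ z in Ioi y, Complex.exp (-(l * (z : ℂ))) * hh U (PhiOp f) f z := by
    unfold PhiOp at e ⊢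
    rw [← e]; ring
  rw [e', ← integral_const_mul]
  congr 1; ext z
  rw [← mul_assoc, ← Complex.exp_add]
  congr 2; push_cast; ring

lemma pOp_cont (hU : BasicFlow U M) (hl : 0 ≤ l.re) (hf : IntegrableOn f (Ioi 0)) :
    ContinuousOn (pOp U l k f) (Ici 0) := by
  have hc := prim_contOn (exp_mul_int hl (hhOp_int hU hf))
  refine ContinuousOn.congr ?_ (fun y hy => pOp_eq hU hl hf hy)
  refine continuousOn_const.mul (ContinuousOn.mul (by fun_prop) (continuousOn_const.sub hc))

lemma contOn_ii (hf : ContinuousOn f (Ici 0)) {y : ℝ} (hy : 0 ≤ y) :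
    IntervalIntegrable f volume 0 y := by
  refine ContinuousOn.intervalIntegrable (hf.mono ?_)
  rw [uIcc_of_le hy]; exact Icc_subset_Ici_self

lemma prim_deriv (hf : ContinuousOn f (Ici 0)) {y : ℝ} (hy : 0 ≤ y) :
    HasDerivWithinAt (PhiOp f) (f y) (Ici 0) y := by
  set fb : ℝ → ℂ := fun y => f (max y 0) with hfb
  have hfc : Continuous fb := by
    refine hf.comp_continuous (by fun_prop) fun x => mem_Ici.2 (le_max_right _ _)
  have h := (hfc.integral_hasStrictDerivAt 0 y).hasDerivAt.hasDerivWithinAt (s := Ici 0)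
  have e : fb y = f y := by simp [hfb, max_eq_left hy]
  rw [e] at h
  have key : ∀ x ∈ Ici (0:ℝ), PhiOp f x = ∫ z in (0:ℝ)..x, fb z := by
    intro x hx
    refine intervalIntegral.integral_congr fun z hz => ?_
    rw [uIcc_of_le hx] at hz
    simp [hfb, max_eq_left hz.1]
  exact h.congr key (key y hy)

lemma TOp_eq (y : ℝ) :
    TOp U l k f y = Complex.exp (-(l * (y : ℂ))) *
      (1 + PhiOp (fun z => Complex.exp (l * z) * pOp U l k f z) y) := by
  unfold TOp PhiOp
  rw [mul_add, mul_one, ← intervalIntegral.integral_const_mul]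
  congr 2; ext z
  rw [← mul_assoc, ← Complex.exp_add]
  congr 2; push_cast; ring

lemma ep_cont (hU : BasicFlow U M) (hl : 0 ≤ l.re) (hf : IntegrableOn f (Ioi 0)) :
    ContinuousOn (fun z : ℝ => Complex.exp (l * z) * pOp U l k f z) (Ici 0) :=
  ContinuousOn.mul (by fun_prop) (pOp_cont hU hl hf)

lemma TOp_cont (hU : BasicFlow U M) (hl : 0 ≤ l.re) (hf : IntegrableOn f (Ioi 0)) :
    ContinuousOn (TOp U l k f) (Ici 0) := by
  have e : TOp U l k f = fun y => _ := funext fun y => TOp_eq y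
  rw [e]
  refine ContinuousOn.mul (by fun_prop) (continuousOn_const.add ?_)
  exact fun y hy => (prim_deriv (ep_cont hU hl hf) hy).continuousWithinAt

lemma TOp_bound (hU : BasicFlow U M) (hl : 6 * (4 * M + 1) ≤ l.re)
    (hk : 0 ≤ k) (hkr : 2 * k ≤ l.re ^ 2) (hf : IntegrableOn f (Ioi 0)) :
    ∫⁻ y in Ioi (0:ℝ), Wt U 0 y * ‖TOp U l k f y‖ₑ < ⊤ := by
  have hM := hU.M_nonneg
  have hr0 : 0 < l.re := by linarith
  have hc := chain2 hU le_rfl zero_le_one hl hk hkr (fun y => ‖TOp U l k f y‖ₑ) (fun y => ‖f y‖ₑ)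
    (fun y => ‖pOp U l k f y‖ₑ) (fun y => ‖hh U (PhiOp f) f y‖ₑ)
    (fun y => ENNReal.ofReal (Real.exp (-(l.re * y)))) (fun y => ENNReal.ofReal (srcF U y))
    hf.1.enorm (aem_of_contOn (pOp_cont hU hr0.le hf)) (hhOp_int hU hf).1.enorm
    (by fun_prop)
    (fun y hy => ?_) (fun y hy => ?_) (hh_enorm_le hU (PhiOp f) f (fun _ _ => rfl))
  · refine hc.trans_lt ?_
    have hle : ∀ g : ℝ → ENNReal, ∫⁻ y in Ioi (0:ℝ), Wt U 0 y * g y ≤ ∫⁻ y in Ioi (0:ℝ), g y :=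
      fun g => setLIntegral_mono' measurableSet_Ioi fun y hy =>
        mul_le_of_le_one_left zero_le (Wt_le_one hU le_rfl (le_of_lt hy))
    have h1 : (∫⁻ y in Ioi (0:ℝ), Wt U 0 y * ENNReal.ofReal (Real.exp (-(l.re * y)))) < ⊤ :=
      (hle _).trans_lt (by rw [lintegral_exp _ hr0]; exact ENNReal.ofReal_lt_top)
    have h2 : (∫⁻ y in Ioi (0:ℝ), Wt U 0 y * ‖f y‖ₑ) < ⊤ := (hle _).trans_lt hf.2
    have h3 : (∫⁻ y in Ioi (0:ℝ), Wt U 0 y * ENNReal.ofReal (srcF U y)) < ⊤ := by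
      refine (hle _).trans_lt ?_
      refine lt_of_le_of_lt (lintegral_mono fun y => ?_) hU.F_int.2
      exact Real.ofReal_le_enorm _
    finiteness
  · rw [← enorm_exp_real]
    refine (enorm_add_le _ _).trans ?_
    gcongr
    exact enorm_forward l _ hy.le
  · rw [pOp, enorm_mul]
    gcongr
    · rw [← ofReal_norm]
      simp [abs_of_nonneg hk]
    · exact enorm_tail l _ hy.le

lemma h0_enorm_le (hU : BasicFlow U M) (v : ℝ → ℂ) (y : ℝ) (hy : 0 < y) :
    ‖h0 U (PhiOp v) v y‖ₑ ≤ ‖v y‖ₑ + ENNReal.ofReal (deriv U y) *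
        (∫⁻ z in Ioi (0:ℝ), KB 0 z y * ‖v z‖ₑ) := by
  unfold h0
  have hd := hU.d_nonneg y hy.le
  refine (enorm_sub_le).trans ?_
  gcongr
  · rw [enorm_mul]
    calc ‖(U y : ℂ)‖ₑ * ‖v y‖ₑ ≤ 1 * ‖v y‖ₑ := by
          gcongr
          rw [← ofReal_norm, Complex.norm_real, Real.norm_of_nonneg (hU.nonneg y hy.le)]
          exact ENNReal.ofReal_le_one.2 (hU.le_one y hy.le)
      _ = _ := one_mul _
  · rw [enorm_mul]
    gcongr
    · rw [← ofReal_norm, Complex.norm_real, Real.norm_of_nonneg hd]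
    · exact enorm_prim v hy.le

lemma exp_tail_int (hl : 0 ≤ l.re) (hf : IntegrableOn f (Ioi 0)) {y : ℝ} (hy : 0 ≤ y) :
    IntegrableOn (fun z : ℝ => Complex.exp (-(l * ((z - y : ℝ) : ℂ))) * f z) (Ioi y) := by
  have h := ((exp_mul_int hl hf).mono_set (Ioi_subset_Ioi hy)).const_mul (Complex.exp (l * y))
  refine h.congr (Eventually.of_forall fun z => ?_)
  simp only
  rw [← mul_assoc, ← Complex.exp_add]
  congr 2; push_cast; ring

lemma TOp_diff (hU : BasicFlow U M) (hl : 6 * (4 * M + 1) ≤ l.re)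
    (hk : 0 ≤ k) (hkr : 2 * k ≤ l.re ^ 2) (hf : IntegrableOn f (Ioi 0)) (hg : IntegrableOn g (Ioi 0)) :
    ∫⁻ y in Ioi (0:ℝ), Wt U 0 y * ‖TOp U l k f y - TOp U l k g y‖ₑ ≤
      ENNReal.ofReal (3 / 4) * ∫⁻ y in Ioi (0:ℝ), Wt U 0 y * ‖f y - g y‖ₑ := by
  have hM := hU.M_nonneg
  have hr0 : 0 < l.re := by linarith
  have hpf := pOp_cont (k := k) hU hr0.le hf
  have hpg := pOp_cont (k := k) hU hr0.le hg
  have hhf := hhOp_int hU hf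
  have hhg := hhOp_int hU hg
  have hc := chain2 hU le_rfl zero_le_one hl hk hkr
    (fun y => ‖TOp U l k f y - TOp U l k g y‖ₑ) (fun y => ‖f y - g y‖ₑ)
    (fun y => ‖pOp U l k f y - pOp U l k g y‖ₑ)
    (fun y => ‖hh U (PhiOp f) f y - hh U (PhiOp g) g y‖ₑ)
    (fun y => 0) (fun y => 0)
    (hf.1.sub hg.1).enorm (aem_of_contOn (hpf.sub hpg)) (hhf.1.sub hhg.1).enorm
    (by fun_prop)
    (fun y hy => ?_) (fun y hy => ?_) (fun y hy => ?_)
  · simpa using hc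
  · rw [zero_add]
    refine le_trans (le_of_eq ?_) (enorm_forward l _ hy.le)
    have c1 : ContinuousOn (fun z : ℝ => Complex.exp (-(l * ((y - z : ℝ) : ℂ)))) (Ici 0) := by fun_prop
    have i1 : IntervalIntegrable (fun z : ℝ => Complex.exp (-(l * ((y - z : ℝ) : ℂ))) * pOp U l k f z)
      volume 0 y := contOn_ii (c1.mul hpf) hy.le
    have i2 : IntervalIntegrable (fun z : ℝ => Complex.exp (-(l * ((y - z : ℝ) : ℂ))) * pOp U l k g z)
      volume 0 y := contOn_ii (c1.mul hpg) hy.le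
    congr 1
    unfold TOp
    rw [add_sub_add_left_eq_sub, ← intervalIntegral.integral_sub i1 i2]
    congr 1; ext z; ring
  · have : pOp U l k f y - pOp U l k g y = -(Complex.I * k) *
        ∫ z in Ioi y, Complex.exp (-(l * ((z - y : ℝ) : ℂ))) *
          (hh U (PhiOp f) f z - hh U (PhiOp g) g z) := by
      unfold pOp
      rw [← mul_sub, ← integral_sub (exp_tail_int hr0.le hhf hy.le) (exp_tail_int hr0.le hhg hy.le)]
      congr 2; ext z; ring
    rw [this, enorm_mul]
    gcongr
    · rw [← ofReal_norm]
      simp [abs_of_nonneg hk]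
    · exact enorm_tail l _ hy.le
  · rw [add_zero]
    refine le_trans (le_of_eq ?_) (h0_enorm_le hU (fun y => f y - g y) y hy)
    congr 1
    have : PhiOp (fun y => f y - g y) y = PhiOp f y - PhiOp g y :=
      intervalIntegral.integral_sub (intervalIntegrable_of_Ioi hf le_rfl hy.le)
        (intervalIntegrable_of_Ioi hg le_rfl hy.le)
    unfold hh h0
    rw [this]; ring

end

section
variable {U : ℝ → ℝ} {M : ℝ} {l : ℂ} {k : ℝ} {f g : ℝ → ℂ}

/-- The weighted measure. -/
def nuW (U : ℝ → ℝ) : Measure ℝ := (volume.restrict (Ioi (0:ℝ))).withDensity (Wt U 0)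

lemma Wt_ne_zero (y : ℝ) : Wt U 0 y ≠ 0 := by
  unfold Wt
  simp [Real.exp_pos]

lemma nuW_ac (hU : BasicFlow U M) : (volume.restrict (Ioi (0:ℝ))) ≪ nuW U :=
  withDensity_absolutelyContinuous' (measurable_Wt hU 0).aemeasurable
    (Eventually.of_forall fun y => Wt_ne_zero y)

lemma nuW_ac' : nuW U ≪ (volume.restrict (Ioi (0:ℝ))) :=
  withDensity_absolutelyContinuous _ _

lemma lint_nuW (hU : BasicFlow U M) (f : ℝ → ENNReal) (hf : AEMeasurable f (volume.restrict (Ioi 0))) :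
    ∫⁻ y, f y ∂(nuW U) = ∫⁻ y in Ioi (0:ℝ), Wt U 0 y * f y := by
  unfold nuW
  rw [lintegral_withDensity_eq_lintegral_mul₀ (measurable_Wt hU 0).aemeasurable hf]
  rfl

lemma int_of_memLp (hU : BasicFlow U M) (hf : MemLp f 1 (nuW U)) : IntegrableOn f (Ioi 0) := by
  have hm : AEStronglyMeasurable f (volume.restrict (Ioi (0:ℝ))) := hf.1.mono_ac (nuW_ac hU)
  refine ⟨hm, ?_⟩
  have h2 := hf.2
  rw [eLpNorm_one_eq_lintegral_enorm, lint_nuW hU _ hm.enorm] at h2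
  have := l1_of_weight hU (fun y => ‖f y‖ₑ)
    (R := (∫⁻ y in Ioi (0:ℝ), Wt U 0 y * ‖f y‖ₑ).toReal) (by rw [ENNReal.ofReal_toReal h2.ne])
  exact this.trans_lt ENNReal.ofReal_lt_top

lemma TOp_memLp (hU : BasicFlow U M) (hl : 6 * (4 * M + 1) ≤ l.re)
    (hk : 0 ≤ k) (hkr : 2 * k ≤ l.re ^ 2) (hf : IntegrableOn f (Ioi 0)) :
    MemLp (TOp U l k f) 1 (nuW U) := by
  have hM := hU.M_nonneg
  have hr0 : 0 < l.re := by linarith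
  have hm := aesm_of_contOn (TOp_cont (k := k) hU hr0.le hf)
  refine ⟨hm.mono_ac nuW_ac', ?_⟩
  rw [eLpNorm_one_eq_lintegral_enorm, lint_nuW hU _ hm.enorm]
  exact TOp_bound hU hl hk hkr hf

lemma exists_fixed (hU : BasicFlow U M) (hl : 6 * (4 * M + 1) ≤ l.re)
    (hk : 0 ≤ k) (hkr : 2 * k ≤ l.re ^ 2) :
    ∃ v : ℝ → ℂ, IntegrableOn v (Ioi 0) ∧ ContinuousOn v (Ici 0) ∧
      ∀ y, 0 ≤ y → v y = TOp U l k v y := by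
  have hM := hU.M_nonneg
  have hr0 : 0 < l.re := by linarith
  have hI : ∀ f : Lp ℂ 1 (nuW U), IntegrableOn f (Ioi 0) := fun f => int_of_memLp hU (Lp.memLp f)
  let G : Lp ℂ 1 (nuW U) → Lp ℂ 1 (nuW U) := fun f => (TOp_memLp hU hl hk hkr (hI f)).toLp _
  have hG : ContractingWith (3/4) G := by
    refine ⟨by norm_num [← NNReal.coe_lt_coe], fun f g => ?_⟩
    rw [Lp.edist_toLp_toLp, Lp.edist_def, eLpNorm_one_eq_lintegral_enorm,
      eLpNorm_one_eq_lintegral_enorm]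
    have hmf := aesm_of_contOn (TOp_cont (k := k) hU hr0.le (hI f))
    have hmg := aesm_of_contOn (TOp_cont (k := k) hU hr0.le (hI g))
    rw [lint_nuW hU _ (hmf.sub hmg).enorm, lint_nuW hU _ ((hI f).1.sub (hI g).1).enorm]
    have := TOp_diff hU hl hk hkr (hI f) (hI g)
    have e : ENNReal.ofReal (3/4) = ((3/4 : NNReal) : ENNReal) := by
      rw [ENNReal.ofReal]; congr 1; ext; norm_num
    rw [e] at this
    exact this
  have : Nonempty (Lp ℂ 1 (nuW U)) := ⟨0⟩
  set f0 := hG.fixedPoint G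
  have hfix : G f0 = f0 := hG.fixedPoint_isFixedPt
  have hae : TOp U l k f0 =ᵐ[volume.restrict (Ioi (0:ℝ))] f0 := by
    refine (nuW_ac hU).ae_le ?_
    have h1 := (TOp_memLp hU hl hk hkr (hI f0)).coeFn_toLp
    have h2 : (G f0 : ℝ → ℂ) =ᵐ[nuW U] f0 := by rw [hfix]
    exact h1.symm.trans h2
  set v := TOp U l k f0 with hv
  have hvi : IntegrableOn v (Ioi 0) := (hI f0).congr hae.symm
  refine ⟨v, hvi, TOp_cont hU hr0.le (hI f0), fun y hy => ?_⟩
  have hP : ∀ y, 0 ≤ y → PhiOp v y = PhiOp f0 y := by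
    intro y hy
    unfold PhiOp
    rw [intervalIntegral.integral_of_le hy, intervalIntegral.integral_of_le hy]
    exact integral_congr_ae (ae_restrict_of_ae_restrict_of_subset Ioc_subset_Ioi_self hae)
  have hp : ∀ y, 0 ≤ y → pOp U l k v y = pOp U l k f0 y := by
    intro y hy
    unfold pOp
    congr 1
    refine integral_congr_ae ?_
    filter_upwards [ae_restrict_of_ae_restrict_of_subset (Ioi_subset_Ioi hy) hae,
      ae_restrict_mem measurableSet_Ioi] with z hz hzy
    unfold hh
    rw [hz, hP z (hy.trans (le_of_lt hzy))]
  rw [hv]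
  conv_rhs => rw [← hv]
  unfold TOp
  congr 1
  refine intervalIntegral.integral_congr fun z hz => ?_
  rw [uIcc_of_le hy] at hz
  change _ * pOp U l k f0 z = _ * pOp U l k v z
  rw [hp z hz.1]

/-- Half line solution. -/
lemma exists_half (hU : BasicFlow U M) (hl : 6 * (4 * M + 1) ≤ l.re)
    (hk : 0 ≤ k) (hkr : 2 * k ≤ l.re ^ 2) :
    ∃ φ v w : ℝ → ℂ, ∃ L : ℂ,
      (∀ y, 0 ≤ y → HasDerivWithinAt φ (v y) (Ici 0) y) ∧
      (∀ y, 0 ≤ y → HasDerivWithinAt v (w y) (Ici 0) y) ∧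
      (∀ y, 0 ≤ y → HasDerivWithinAt w (l ^ 2 * v y + Complex.I * k * hh U φ v y) (Ici 0) y) ∧
      φ 0 = 0 ∧ v 0 = 1 ∧ Tendsto v atTop (nhds 0) ∧ Tendsto φ atTop (nhds L) := by
  have hM := hU.M_nonneg
  have hr0 : 0 < l.re := by linarith
  obtain ⟨v, hvi, hvc, hvT⟩ := exists_fixed hU hl hk hkr
  have hhi := hhOp_int hU hvi
  set φ := PhiOp v with hφ
  set p := pOp U l k v with hp
  have hpc : ContinuousOn p (Ici 0) := pOp_cont hU hr0.le hvi
  have dφ : ∀ y, 0 ≤ y → HasDerivWithinAt φ (v y) (Ici 0) y := fun y hy => prim_deriv hvc hy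
  have hφc : ContinuousOn φ (Ici 0) := fun y hy => (dφ y hy).continuousWithinAt
  have hhc : ContinuousOn (hh U φ v) (Ici 0) := by
    have h3 : Continuous fun y => (U y : ℂ) := Complex.continuous_ofReal.comp hU.cont
    have h4 : Continuous fun y => ((deriv U y : ℝ) : ℂ) := Complex.continuous_ofReal.comp hU.dcont
    have h5 : Continuous fun y => (srcF U y : ℂ) := Complex.continuous_ofReal.comp (srcF_cont hU)
    exact ((h3.continuousOn.mul hvc).sub (h4.continuousOn.mul hφc)).add h5.continuousOn
  have dexp : ∀ (m : ℂ) (y : ℝ), HasDerivAt (fun y : ℝ => Complex.exp (m * (y : ℂ)))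
      (m * Complex.exp (m * (y : ℂ))) y := by
    intro m y
    have := cexp_hasDerivAt (-m) y
    simpa using this
  have ee : ∀ y : ℝ, Complex.exp (l * y) * Complex.exp (-(l * y)) = 1 := by
    intro y; rw [← Complex.exp_add]; simp
  have dp : ∀ y, 0 ≤ y → HasDerivWithinAt p (l * p y + Complex.I * k * hh U φ v y) (Ici 0) y := by
    intro y hy
    have c1 : ContinuousOn (fun z : ℝ => Complex.exp (-(l * (z : ℂ))) * hh U φ v z) (Ici 0) :=
      ContinuousOn.mul (by fun_prop) hhc
    have h1 := ((dexp l y).hasDerivWithinAt (s := Ici 0)).mul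
      ((prim_deriv c1 hy).const_sub
        (∫ z in Ioi (0:ℝ), Complex.exp (-(l * (z : ℂ))) * hh U φ v z))
    have h2 := (h1.const_mul (-(Complex.I * k))).congr (f₁ := p)
      (fun x hx => pOp_eq hU hr0.le hvi hx) (pOp_eq hU hr0.le hvi hy)
    refine h2.congr_deriv ?_
    have e1 : p y = _ := pOp_eq hU hr0.le hvi hy
    rw [e1]
    linear_combination (Complex.I * k * hh U φ v y) * ee y
  have dv : ∀ y, 0 ≤ y → HasDerivWithinAt v (p y - l * v y) (Ici 0) y := by
    intro y hy
    have h1 := ((cexp_hasDerivAt l y).hasDerivWithinAt (s := Ici 0)).mul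
      ((prim_deriv (ep_cont (k := k) hU hr0.le hvi) hy).const_add 1)
    have h2 := h1.congr (f₁ := v)
      (fun x hx => (hvT x hx).trans (TOp_eq x)) ((hvT y hy).trans (TOp_eq y))
    refine h2.congr_deriv ?_
    have e1 : v y = _ := (hvT y hy).trans (TOp_eq y)
    rw [e1]
    linear_combination (p y) * ee y
  have hpi : IntegrableOn p (Ioi 0) := by
    refine ⟨aesm_of_contOn hpc, ?_⟩
    have hs := schur (fun y z => KB l.re y z) (measurable_KB l.re) (fun z => ‖hh U φ v z‖ₑ)
      (Wt U 0) (Wt U 0) hhi.1.enorm (measurable_Wt hU 0) (ENNReal.ofReal (1 / (l.re - 4 * M)))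
      (fun z hz => Wt_KB_le hU (by linarith) (by linarith) hz) (measurable_Wt hU 0)
    have hfin : ∫⁻ y in Ioi (0:ℝ), Wt U 0 y * ‖p y‖ₑ < ⊤ := by
      calc ∫⁻ y in Ioi (0:ℝ), Wt U 0 y * ‖p y‖ₑ ≤
          ∫⁻ y in Ioi (0:ℝ), ENNReal.ofReal k *
            (Wt U 0 y * ∫⁻ z in Ioi (0:ℝ), KB l.re y z * ‖hh U φ v z‖ₑ) := by
            refine setLIntegral_mono' measurableSet_Ioi fun y hy => ?_
            rw [mul_left_comm]
            gcongr
            rw [hp, pOp, enorm_mul]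
            gcongr
            · rw [← ofReal_norm]
              simp [abs_of_nonneg hk]
            · exact enorm_tail l _ (le_of_lt hy)
        _ = ENNReal.ofReal k * ∫⁻ y in Ioi (0:ℝ),
            (Wt U 0 y * ∫⁻ z in Ioi (0:ℝ), KB l.re y z * ‖hh U φ v z‖ₑ) :=
            lintegral_const_mul' _ _ ENNReal.ofReal_ne_top
        _ ≤ ENNReal.ofReal k * (ENNReal.ofReal (1 / (l.re - 4 * M)) *
            ∫⁻ z in Ioi (0:ℝ), ‖hh U φ v z‖ₑ) := by
            gcongr
            refine hs.trans ?_
            refine mul_le_mul_right ?_ _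
            exact setLIntegral_mono' measurableSet_Ioi fun y hy =>
              mul_le_of_le_one_left zero_le (Wt_le_one hU le_rfl (le_of_lt hy))
        _ < ⊤ := by
            have := hhi.2
            have h3 : ∫⁻ z in Ioi (0:ℝ), ‖hh U φ v z‖ₑ < ⊤ := this
            exact ENNReal.mul_lt_top ENNReal.ofReal_lt_top (ENNReal.mul_lt_top ENNReal.ofReal_lt_top h3)
    have := l1_of_weight hU (fun y => ‖p y‖ₑ)
      (R := (∫⁻ y in Ioi (0:ℝ), Wt U 0 y * ‖p y‖ₑ).toReal) (by rw [ENNReal.ofReal_toReal hfin.ne])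
    exact this.trans_lt ENNReal.ofReal_lt_top
  refine ⟨φ, v, fun y => p y - l * v y, ∫ z in Ioi (0:ℝ), v z, dφ, dv, fun y hy => ?_, ?_, ?_, ?_, ?_⟩
  · refine ((dp y hy).sub ((dv y hy).const_mul l)).congr_deriv ?_
    ring
  · simp [hφ, PhiOp]
  · rw [hvT 0 le_rfl]; simp [TOp]
  · refine tendsto_zero_of_hasDerivAt_of_integrableOn_Ioi (a := 0) (f' := fun y => p y - l * v y)
      (fun y hy => ?_) (hpi.sub (hvi.const_mul l)) hvi
    exact (dv y (le_of_lt hy)).hasDerivAt (Ici_mem_nhds hy)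
  · exact intervalIntegral_tendsto_integral_Ioi 0 hvi tendsto_id

end

section

lemma smooth_extend {E : Type*} [NormedAddCommGroup E] [NormedSpace ℝ E] [CompleteSpace E]
    (G : E → E) (hG : ContDiff ℝ (⊤ : ℕ∞) G) (X : ℝ → E)
    (hX : ∀ y, 0 ≤ y → HasDerivWithinAt X (G (X y)) (Ici 0) y) :
    ∃ Y : ℝ → E, ∃ ε > 0, (∀ y, 0 ≤ y → Y y = X y) ∧
      (∀ y, -ε < y → HasDerivAt Y (G (Y y)) y) ∧ ContDiffOn ℝ (⊤ : ℕ∞) Y (Ioi (-ε)) := by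
  have hG1 : ContDiffAt ℝ 1 G (X 0) := hG.contDiffAt.of_le (by simp)
  obtain ⟨α, hα0, ε, hε, hα⟩ :=
    hG1.exists_forall_mem_closedBall_exists_eq_forall_mem_Ioo_hasDerivAt₀ 0
  simp only [zero_sub, zero_add] at hα
  set Y : ℝ → E := fun y => if y ≤ 0 then α y else X y with hY
  have hYr : ∀ y, 0 ≤ y → Y y = X y := by
    intro y hy
    rcases hy.eq_or_lt with h | h
    · simp [hY, ← h, hα0]
    · simp [hY, not_le.2 h]
  have hYl : ∀ y, y ≤ 0 → Y y = α y := fun y hy => by simp [hY, hy]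
  have hd : ∀ y, -ε < y → HasDerivAt Y (G (Y y)) y := by
    intro y hy
    rcases lt_trichotomy y 0 with h | h | h
    · rw [hYl y h.le]
      refine (hα y ⟨hy, by linarith⟩).congr_of_eventuallyEq ?_
      filter_upwards [Iio_mem_nhds h] with z hz
      exact hYl z (le_of_lt hz)
    · subst h
      have h1 : HasDerivWithinAt Y (G (Y 0)) (Iic 0) 0 := by
        rw [hYl 0 le_rfl]
        exact (hα 0 ⟨hy, hε⟩).hasDerivWithinAt.congr (fun z hz => hYl z hz) (hYl 0 le_rfl)
      have h2 : HasDerivWithinAt Y (G (Y 0)) (Ici 0) 0 := by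
        rw [hYr 0 le_rfl]
        exact (hX 0 le_rfl).congr (fun z hz => hYr z hz) (hYr 0 le_rfl)
      have := h1.union h2
      rw [Iic_union_Ici] at this
      exact hasDerivWithinAt_univ.1 this
    · rw [hYr y h.le]
      refine ((hX y h.le).hasDerivAt (Ici_mem_nhds h)).congr_of_eventuallyEq ?_
      filter_upwards [Ioi_mem_nhds h] with z hz
      exact hYr z (le_of_lt hz)
  refine ⟨Y, ε, hε, hYr, hd, ?_⟩
  refine contDiffOn_infty.2 fun n => ?_
  induction n with
  | zero =>
    exact contDiffOn_zero.2 fun y hy => (hd y hy).continuousAt.continuousWithinAt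
  | succ n ih =>
    push_cast
    rw [contDiffOn_succ_iff_deriv_of_isOpen isOpen_Ioi]
    refine ⟨fun y hy => (hd y hy).differentiableAt.differentiableWithinAt, by simp, ?_⟩
    have : ContDiffOn ℝ n (fun y => G (Y y)) (Ioi (-ε)) :=
      (hG.of_le (by exact_mod_cast le_top)).comp_contDiffOn ih
    exact this.congr fun y hy => (hd y hy).deriv

lemma cutoff_extend (φ : ℝ → ℂ) {ε : ℝ} (hε : 0 < ε) (hφ : ContDiffOn ℝ (⊤ : ℕ∞) φ (Ioi (-ε))) :
    ∃ ψ : ℝ → ℂ, ContDiff ℝ (⊤ : ℕ∞) ψ ∧ ∀ y, -(ε / 4) < y → ψ y = φ y := by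
  have hχ : ContDiff ℝ (⊤ : ℕ∞) (fun y : ℝ => Real.smoothTransition ((y + ε / 2) * (4 / ε))) :=
    Real.smoothTransition.contDiff.comp (by fun_prop)
  refine ⟨fun y => Real.smoothTransition ((y + ε / 2) * (4 / ε)) • φ y, ?_, fun y hy => ?_⟩
  · rw [contDiff_iff_contDiffAt]
    intro y
    rcases lt_or_ge (-ε) y with h | h
    · exact hχ.contDiffAt.smul (hφ.contDiffAt (Ioi_mem_nhds h))
    · have hc : ContDiffAt ℝ (⊤ : ℕ∞) (fun _ : ℝ => (0:ℂ)) y := contDiffAt_const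
      refine hc.congr_of_eventuallyEq ?_
      filter_upwards [Iio_mem_nhds (show y < -(ε/2) by linarith)] with z hz
      rw [Real.smoothTransition.zero_of_nonpos, zero_smul]
      refine mul_nonpos_of_nonpos_of_nonneg ?_ (by positivity)
      have : z < -(ε/2) := hz
      linarith
  · simp only
    rw [Real.smoothTransition.one_of_one_le, one_smul]
    rw [← mul_div_assoc, le_div_iff₀ hε]
    linarith

variable {U : ℝ → ℝ} {M : ℝ} {l : ℂ} {k : ℝ}

/-- autonomous vector field -/
def Gf (U : ℝ → ℝ) (l : ℂ) (k : ℝ) (X : ℝ × ℂ × ℂ × ℂ) : ℝ × ℂ × ℂ × ℂ :=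
  (1, X.2.2.1, X.2.2.2, l ^ 2 * X.2.2.1 + Complex.I * k *
    ((U X.1 : ℂ) * X.2.2.1 - ((deriv U X.1 : ℝ) : ℂ) * X.2.1 + (srcF U X.1 : ℂ)))

lemma Gf_smooth (hU : BasicFlow U M) : ContDiff ℝ (⊤ : ℕ∞) (Gf U l k) := by
  have h1 := hU.smooth
  have h2 : ContDiff ℝ (⊤ : ℕ∞) (deriv U) := (contDiff_infty_iff_deriv.1 h1).2
  have h3 : ContDiff ℝ (⊤ : ℕ∞) (srcF U) := by
    unfold srcF
    exact (contDiff_const.sub h1).add (contDiff_id.mul h2)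
  have c : ∀ g : ℝ → ℝ, ContDiff ℝ (⊤ : ℕ∞) g →
      ContDiff ℝ (⊤ : ℕ∞) (fun X : ℝ × ℂ × ℂ × ℂ => (g X.1 : ℂ)) := fun g hg =>
    Complex.ofRealCLM.contDiff.comp (hg.comp contDiff_fst)
  have c1 := c _ h1
  have c2 := c _ h2
  have c3 := c _ h3
  unfold Gf
  fun_prop

lemma exists_smooth (hU : BasicFlow U M) {φ v w : ℝ → ℂ}
    (hφ : ∀ y, 0 ≤ y → HasDerivWithinAt φ (v y) (Ici 0) y)
    (hv : ∀ y, 0 ≤ y → HasDerivWithinAt v (w y) (Ici 0) y)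
    (hw : ∀ y, 0 ≤ y → HasDerivWithinAt w (l ^ 2 * v y + Complex.I * k * hh U φ v y) (Ici 0) y) :
    ∃ ψ : ℝ → ℂ, ContDiff ℝ (⊤ : ℕ∞) ψ ∧ ∀ y, 0 ≤ y → ψ y = φ y ∧ deriv ψ y = v y ∧
      iteratedDeriv 3 ψ y = l ^ 2 * v y + Complex.I * k * hh U φ v y := by
  obtain ⟨Y, ε, hε, hYX, hYd, hYs⟩ := smooth_extend (Gf U l k) (Gf_smooth hU)
    (fun y => (y, φ y, v y, w y)) (fun y hy =>
      ((hasDerivAt_id y).hasDerivWithinAt).prodMk ((hφ y hy).prodMk ((hv y hy).prodMk (hw y hy))))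
  have hs : ContDiffOn ℝ (⊤ : ℕ∞) (fun y => (Y y).2.1) (Ioi (-ε)) := by fun_prop
  obtain ⟨ψ, hψ, hψe⟩ := cutoff_extend _ hε hs
  refine ⟨ψ, hψ, ?_⟩
  have d1 : ∀ y, -ε < y → HasDerivAt (fun y => (Y y).2.1) (Y y).2.2.1 y := fun y hy =>
    (hYd y hy).snd.fst
  have d2 : ∀ y, -ε < y → HasDerivAt (fun y => (Y y).2.2.1) (Y y).2.2.2 y := fun y hy =>
    (hYd y hy).snd.snd.fst
  have d3 : ∀ y, -ε < y → HasDerivAt (fun y => (Y y).2.2.2) (Gf U l k (Y y)).2.2.2 y := fun y hy =>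
    (hYd y hy).snd.snd.snd
  have e0 : ∀ y, -(ε/4) < y → ∀ᶠ z in nhds y, -(ε/4) < z := fun y hy => Ioi_mem_nhds hy
  have e1 : ∀ y, -(ε/4) < y → deriv ψ y = (Y y).2.2.1 := by
    intro y hy
    refine HasDerivAt.deriv ((d1 y (by linarith)).congr_of_eventuallyEq ?_)
    filter_upwards [e0 y hy] with z hz using hψe z hz
  have e2 : ∀ y, -(ε/4) < y → deriv (deriv ψ) y = (Y y).2.2.2 := by
    intro y hy
    refine HasDerivAt.deriv ((d2 y (by linarith)).congr_of_eventuallyEq ?_)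
    filter_upwards [e0 y hy] with z hz using e1 z hz
  have e3 : ∀ y, -(ε/4) < y → deriv (deriv (deriv ψ)) y = (Gf U l k (Y y)).2.2.2 := by
    intro y hy
    refine HasDerivAt.deriv ((d3 y (by linarith)).congr_of_eventuallyEq ?_)
    filter_upwards [e0 y hy] with z hz using e2 z hz
  intro y hy
  have hy' : -(ε/4) < y := by linarith
  have hX := hYX y hy
  refine ⟨?_, ?_, ?_⟩
  · rw [hψe y hy', hX]
  · rw [e1 y hy', hX]
  · rw [iteratedDeriv_succ, iteratedDeriv_succ, iteratedDeriv_one, e3 y hy', hX]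
    rfl

/-- algebra between the two forms of the ODE -/
lemma ode_iff {μ : ℂ} (hk : 0 < k) (hμ : -(Complex.I * k * μ) = l ^ 2) {u d F v φ t : ℂ} :
    (μ - u) * v + d * φ - Complex.I / (k : ℂ) * t = F ↔
      t = l ^ 2 * v + Complex.I * k * (u * v - d * φ + F) := by
  have hk' : (k : ℂ) ≠ 0 := by exact_mod_cast hk.ne'
  rw [← hμ]
  have hI : Complex.I * Complex.I = -1 := Complex.I_mul_I
  constructor
  · intro h
    have : Complex.I * k * (Complex.I / (k : ℂ) * t) = -t := by
      field_simp
      linear_combination t * hI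
    rw [← h]
    linear_combination this
  · intro h
    rw [h]
    have : Complex.I / (k : ℂ) * (-(Complex.I * k * μ) * v + Complex.I * k * (u * v - d * φ + F)) =
        Complex.I * Complex.I * (-μ * v + (u * v - d * φ + F)) := by
      field_simp
    rw [this, hI]; ring

lemma exists_BL (hU : BasicFlow U M) (hl : 6 * (4 * M + 1) ≤ l.re)
    (hk : 0 < k) (hkr : 2 * k ≤ l.re ^ 2) {μ : ℂ} (hμ : -(Complex.I * k * μ) = l ^ 2) :
    ∃ φ : ℝ → ℂ, ∃ L : ℂ, IsBLSolution U μ k φ ∧ Tendsto φ atTop (nhds L) := by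
  obtain ⟨φ, v, w, L, hφ, hv, hw, h0, h1, hv0, hφL⟩ := exists_half hU hl hk.le hkr
  obtain ⟨ψ, hψ, h⟩ := exists_smooth hU hφ hv hw
  refine ⟨ψ, L, ⟨hψ, fun y hy => ?_, ?_, ?_, ?_⟩, ?_⟩
  · obtain ⟨a, b, c⟩ := h y hy
    rw [ode_iff hk hμ, c, a, b]
    rfl
  · rw [(h 0 le_rfl).1, h0]
  · rw [(h 0 le_rfl).2.1, h1]
  · refine hv0.congr' ?_
    filter_upwards [eventually_ge_atTop (0:ℝ)] with y hy
    exact (h y hy).2.1.symm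
  · refine hφL.congr' ?_
    filter_upwards [eventually_ge_atTop (0:ℝ)] with y hy
    exact (h y hy).1.symm

lemma BL_sol {φ : ℝ → ℂ} (hk : 0 < k) {μ : ℂ} (hμ : -(Complex.I * k * μ) = l ^ 2)
    (h : IsBLSolution U μ k φ) : Sol U l k φ (deriv φ) (deriv (deriv φ)) := by
  obtain ⟨hs, hode, h0, h1, -⟩ := h
  have s1 := contDiff_infty_iff_deriv.1 hs
  have s2 := contDiff_infty_iff_deriv.1 s1.2
  have s3 := contDiff_infty_iff_deriv.1 s2.2
  refine ⟨fun y _ => (s1.1 y).hasDerivAt, fun y _ => (s2.1 y).hasDerivAt, fun y hy => ?_, h0, h1⟩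
  have h3 := (s3.1 y).hasDerivAt
  have e := (ode_iff hk hμ).1 (hode y hy)
  rw [iteratedDeriv_succ, iteratedDeriv_succ, iteratedDeriv_one] at e
  rw [e] at h3
  exact h3

end

lemma high_osc_real {a im k r rs E D M B : ℝ} (ha : 0 < a) (him : 0 < im) (hia : im ≤ a)
    (hk : 0 < k) (hr : r = k * rs) (hrs : 0 < rs) (h2 : a ≤ 2 * rs ^ 2) (hE : 0 ≤ E) (hD : 0 ≤ D)
    (hM : 0 ≤ M)
    (hB : B ≤ k * (4 * (E * (4 * (1 / r + 2 * k / r ^ 2 * (2 * D)))) + 2 * (1 + M) / r)) :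
    B / (k ^ 2 * a) ≤ (32 * E + 4 * (1 + M) + 128 * E * D) / k ^ 2 * (1 / im) *
      (1 / a + 1 / Real.sqrt a) := by
  set q := Real.sqrt a with hq
  have hqp : 0 < q := Real.sqrt_pos.2 ha
  have hqq : q ^ 2 = a := Real.sq_sqrt ha.le
  have hqr : q ≤ 2 * rs := by nlinarith
  have e1 : 1 / r ≤ 2 / (k * q) := by
    rw [hr, div_le_div_iff₀ (by positivity) (by positivity)]
    nlinarith
  have e2 : k / r ^ 2 ≤ 2 / (k * a) := by
    rw [hr, div_le_div_iff₀ (by positivity) (by positivity)]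
    nlinarith [mul_le_mul_of_nonneg_left h2 (sq_nonneg k)]
  have hB2 : B ≤ (32 * E + 4 * (1 + M)) * (1 / q) + 128 * E * D * (1 / a) := by
    have : k * (4 * (E * (4 * (1 / r + 2 * k / r ^ 2 * (2 * D)))) + 2 * (1 + M) / r)
      = k * ((16 * E + 2 * (1 + M)) * (1 / r)  + 64 * E * D * (k / r ^ 2)) := by ring
    rw [this] at hB
    refine hB.trans ?_
    have : k * ((16 * E + 2 * (1 + M)) * (1 / r)  + 64 * E * D * (k / r ^ 2)) ≤
      k * ((16 * E + 2 * (1 + M)) * (2 / (k * q))  + 64 * E * D * (2 / (k * a))) := by gcongr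
    refine this.trans (le_of_eq ?_)
    field_simp
    ring
  have hB3 : B ≤ (32 * E + 4 * (1 + M) + 128 * E * D) * (1 / a + 1 / q) := by
    have h1 : 0 ≤ (32 * E + 4 * (1 + M)) * (1 / a) := by positivity
    have h2 : 0 ≤ 128 * E * D * (1 / q) := by positivity
    nlinarith
  have : B / (k ^ 2 * a) ≤ (32 * E + 4 * (1 + M) + 128 * E * D) * (1 / a + 1 / q) / (k ^ 2 * im) := by
    gcongr
  refine this.trans (le_of_eq ?_)
  field_simp

/-- Lemma (high-oscillation approximation of `Φ(iαk, k)` by `f(α)/k`). -/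
theorem high_oscillation_approx (U ω : ℝ → ℝ)
    (hU : AdmissibleShearFlow U) (hω : WeightFn ω) (hdec : WeightedDecay U ω)
    (η : ℝ) (hη : 0 < η) :
    ∃ C K : ℝ, 0 < C ∧ 0 < K ∧
      ∀ k : ℕ, K ≤ (k : ℝ) → ∀ α : ℂ,
        η / (k : ℝ) ≤ α.re → 4 / (k : ℝ) ≤ |α.im| →
        (∃ φ : ℝ → ℂ, ∃ L : ℂ,
          IsBLSolution U (Complex.I * α * (k : ℂ)) (k : ℝ) φ ∧
          Tendsto φ atTop (nhds L)) ∧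
        ∀ φ : ℝ → ℂ, ∀ L : ℂ,
          IsBLSolution U (Complex.I * α * (k : ℂ)) (k : ℝ) φ →
          Tendsto φ atTop (nhds L) →
          ‖L - (1 / (k : ℂ)) * fIBL (deltaS U) α‖ ≤
            C / (k : ℝ) ^ 2 * (1 / |α.im|) * (1 / ‖α‖ + 1 / Real.sqrt ‖α‖) := by
  obtain ⟨M, hB⟩ := hU.basic
  have hM : 0 ≤ M := hB.M_nonneg
  have hD : 0 ≤ deltaS U := by
    unfold deltaS
    refine setIntegral_nonneg measurableSet_Ioi fun y hy => ?_
    have := (hU.mem_Ico y (le_of_lt hy)).2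
    linarith
  refine ⟨32 * Real.exp 4 + 4 * (1 + M) + 128 * Real.exp 4 * deltaS U, (6 * (4 * M + 1)) ^ 2,
    by positivity, by positivity, ?_⟩
  intro k hK α hre him
  have hk : 0 < (k : ℝ) := lt_of_lt_of_le (by positivity) hK
  have hre0 : 0 < α.re := lt_of_lt_of_le (by positivity) hre
  have him0 : 0 < |α.im| := lt_of_lt_of_le (by positivity) him
  have hia : |α.im| ≤ ‖α‖ := Complex.abs_im_le_norm α
  have ha : 0 < ‖α‖ := him0.trans_le hia
  have hα : α ≠ 0 := norm_pos_iff.1 ha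
  set s : ℂ := α ^ (1/2 : ℂ) with hs
  have hss : s ^ 2 = α := by
    rw [hs, ← Complex.cpow_nat_mul]
    norm_num
  have hs0 : s ≠ 0 := by
    intro h
    rw [h] at hss
    exact hα (by rw [← hss]; simp)
  have hsre : 0 < s.re := by
    rw [hs, Complex.cpow_def_of_ne_zero hα, Complex.exp_re]
    refine mul_pos (Real.exp_pos _) (Real.cos_pos_of_mem_Ioo ?_)
    have e : (Complex.log α * (1/2)).im = Complex.arg α / 2 := by
      rw [show (1/2 : ℂ) = ((1/2 : ℝ) : ℂ) by push_cast; rfl, Complex.im_mul_ofReal, Complex.log_im]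
      ring
    rw [e]
    have h1 := Complex.neg_pi_lt_arg α
    have h2 : |α.arg| < Real.pi / 2 := Complex.abs_arg_lt_pi_div_two_iff.2 (Or.inl hre0)
    rw [abs_lt] at h2
    constructor <;> linarith [Real.pi_pos]
  have h2 : ‖α‖ ≤ 2 * s.re ^ 2 := by
    have e1 : ‖α‖ = s.re ^ 2 + s.im ^ 2 := by
      rw [← hss, norm_pow, ← Complex.normSq_eq_norm_sq, Complex.normSq_apply]
      ring
    have e2 : α.re = s.re ^ 2 - s.im ^ 2 := by
      rw [← hss, sq, Complex.mul_re]
      ring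
    linarith
  set l : ℂ := ((k : ℝ) : ℂ) * s with hl
  have hlre : l.re = k * s.re := by rw [hl, Complex.re_ofReal_mul]
  have h4 : 4 ≤ k * ‖α‖ := by
    have := him.trans hia
    rwa [div_le_iff₀ hk, mul_comm] at this
  have hkr : 2 * (k : ℝ) ≤ l.re ^ 2 := by
    rw [hlre]
    nlinarith [mul_le_mul_of_nonneg_left h2 (sq_nonneg (k : ℝ))]
  have hrpos : 0 < l.re := by rw [hlre]; positivity
  have hbig : 6 * (4 * M + 1) ≤ l.re := by
    refine le_of_sq_le_sq ?_ hrpos.le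
    linarith
  have hμ : -(Complex.I * ((k : ℝ) : ℂ) * (Complex.I * α * (k : ℂ))) = l ^ 2 := by
    rw [hl, mul_pow, hss]
    push_cast
    linear_combination (-(k : ℂ) ^ 2 * α) * Complex.I_sq
  refine ⟨exists_BL hB hbig hk hkr hμ, ?_⟩
  intro φ L hφ hL
  have est := (BL_sol hk hμ hφ).estimate hB hbig hk.le hkr hφ.2.2.2.2 hL
  have hkc : (k : ℂ) ≠ 0 := by exact_mod_cast hk.ne'
  have hl2 : l ^ 2 = (k : ℂ) ^ 2 * α := by
    rw [hl, mul_pow, hss]; push_cast; rfl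
  have key : L - (1 / (k : ℂ)) * fIBL (deltaS U) α =
      (l ^ 2 * L - (l - Complex.I * ((k : ℝ) : ℂ) * (2 * (deltaS U : ℂ)))) / ((k : ℂ) ^ 2 * α) := by
    rw [hl2, fIBL, ← hs, hl, ← hss]
    push_cast
    field_simp
    ring
  rw [key, norm_div]
  have hn : ‖(k : ℂ) ^ 2 * α‖ = (k : ℝ) ^ 2 * ‖α‖ := by simp
  rw [hn]
  exact high_osc_real ha him0 hia hk hlre hsre h2 (Real.exp_pos 4).le hD hM est

end
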